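/- arXiv:2508.14612 — 4 statements merged into one kernel-verified Lean document; each statement's English description precedes it below -/
import Mathlib

section
/- For the Mochizuki 3-cocycle ζ of the 7-dihedral quandle R₇, one has l(ζ, ℤ×R₇) ≥ 8. Precisely: the 3-chain γ = +(0,0;0,6,1) − (1,5;5,1,4) − (0,0;1,6,0) + (1,2;6,3,0) + (0,0;0,1,6) − (1,2;2,6,3) − (0,0;6,1,0) + (1,5;1,4,0) of (R₇, ℤ×R₇) (each generator written as (degree, index; color)) is a 3-cycle with ζ(π(γ)) = 6 ≠ 0 in ℤ/7ℤ; and every 3-cycle γ of (R₇, ℤ×R₇) with ζ(π(γ)) ≠ 0 has length l(γ) ≥ 8. -/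
namespace QHom

variable {X S : Type*}

/-- Generating tuples: an element of `S` together with a list of quandle elements
whose consecutive entries are distinct. -/
abbrev Gen (X S : Type*) := {p : S × List X // p.2.Chain' (· ≠ ·)}

/-- The chain group: the free abelian group on `Gen X S`. -/
abbrev Ch (X S : Type*) := Gen X S →₀ ℤ

/-- The basis chain associated to a tuple; `0` if two consecutive entries coincide. -/
noncomputable def gen (s : S) (l : List X) : Ch X S := by
  classical
  exact if h : l.Chain' (· ≠ ·) then Finsupp.single ⟨(s, l), h⟩ 1 else 0

noncomputable def fOn (t : Gen X S) : Ch X S :=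
  ∑ j : Fin t.1.2.length, ((-1 : ℤ) ^ ((j : ℕ) + 1)) • gen t.1.1 (t.1.2.eraseIdx (j : ℕ))

/-- The map `f`. -/
noncomputable def fmap (γ : Ch X S) : Ch X S := γ.sum fun t c => c • fOn t

noncomputable def gOn (op : X → X → X) (sact : S → X → S) (t : Gen X S) : Ch X S :=
  ∑ j : Fin t.1.2.length,
    ((-1 : ℤ) ^ (j : ℕ)) •
      gen (sact t.1.1 (t.1.2.get j))
        ((t.1.2.take (j : ℕ)).map (fun x => op x (t.1.2.get j)) ++ t.1.2.drop ((j : ℕ) + 1))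

/-- The map `g`. -/
noncomputable def gmap (op : X → X → X) (sact : S → X → S) (γ : Ch X S) : Ch X S :=
  γ.sum fun t c => c • gOn op sact t

/-- The boundary map `∂ = f + g`. -/
noncomputable def bd (op : X → X → X) (sact : S → X → S) (γ : Ch X S) : Ch X S :=
  fmap γ + gmap op sact γ

/-- `γ` is an `m`-chain: it is supported on tuples of length `m`. -/
def IsMChain (m : ℕ) (γ : Ch X S) : Prop := ∀ t ∈ γ.support, t.1.2.length = m

/-- The length of a chain: the sum of the absolute values of its coefficients. -/
noncomputable def chainLen (γ : Ch X S) : ℕ := γ.sum fun _ c => c.natAbs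

/-- `π` : forget the `S`-coordinate. -/
noncomputable def proj (γ : Ch X S) : Ch X Unit := γ.sum fun t c => c • gen () t.1.2

/-- Evaluation of a cochain (given by its values on generating tuples) on a chain. -/
noncomputable def evalCh {A : Type*} [AddCommGroup A] (θ : List X → A) (δ : Ch X Unit) : A :=
  δ.sum fun t c => c • θ t.1.2

/-- The action of quandle generators on the `X`-set `ℤ × X`. -/
def zact (op : X → X → X) (s : ℤ × X) (a : X) : ℤ × X := (s.1 + 1, op s.2 a)

/-- `γ` is a 3-term of degree `n` and index `u`. -/
def IsTerm3 (γ : Ch X (ℤ × X)) (n : ℤ) (u : X) : Prop :=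
  ∃ ε a b c, (ε = (1 : ℤ) ∨ ε = -1) ∧ a ≠ b ∧ b ≠ c ∧ γ = ε • gen (n, u) [a, b, c]

def Efficient {k : ℕ} (γ : Fin k → Ch X S) : Prop := ∀ i j, i ≠ j → γ i ≠ -γ j

def FConnected {k : ℕ} (γ : Fin k → Ch X S) : Prop :=
  Efficient γ ∧ (∑ i, fmap (γ i)) = 0 ∧
    ∀ I : Finset (Fin k), I.Nonempty → I ≠ Finset.univ → (∑ i ∈ I, fmap (γ i)) ≠ 0

def GConnected {k : ℕ} (op : X → X → X) (sact : S → X → S) (γ : Fin k → Ch X S) : Prop :=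
  Efficient γ ∧ (∑ i, gmap op sact (γ i)) = 0 ∧
    ∀ I : Finset (Fin k), I.Nonempty → I ≠ Finset.univ → (∑ i ∈ I, gmap op sact (γ i)) ≠ 0

/-- `n` is the minimal degree of `γ`. -/
def MinDegree (γ : Ch X (ℤ × X)) (n : ℤ) : Prop :=
  (∃ t ∈ γ.support, t.1.1.1 = n) ∧ ∀ t ∈ γ.support, n ≤ t.1.1.1

/-- `|T_k(γ)|`: the number of terms (with multiplicity) of `γ` of degree `k`. -/
noncomputable def Tcount (γ : Ch X (ℤ × X)) (k : ℤ) : ℕ :=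
  γ.sum fun t c => if t.1.1.1 = k then c.natAbs else 0

def revList (op : X → X → X) : List X → List X
  | [] => []
  | a :: l => l.foldl op a :: revList op l

/-- The reverse of a chain of `(X, ℤ × X)` (a chain of the dual quandle). -/
noncomputable def reverse (op : X → X → X) (γ : Ch X (ℤ × X)) : Ch X (ℤ × X) :=
  γ.sum fun t c => c • gen (-t.1.1.1, t.1.2.foldl op t.1.1.2) (revList op t.1.2)

/-- The degree-shift automorphism `σ`. -/
noncomputable def sigmaMap (γ : Ch X (ℤ × X)) : Ch X (ℤ × X) :=
  γ.sum fun t c => c • gen (t.1.1.1 + 1, t.1.1.2) t.1.2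

/-- `γ` is a 3-term of type `ty` with respect to the operation `op`. -/
def IsTypedTerm (op : X → X → X) (γ : Ch X (ℤ × X)) (ty : ℕ) : Prop :=
  ∃ (ε n : ℤ) (u a b c : X), (ε = 1 ∨ ε = -1) ∧ a ≠ b ∧ b ≠ c ∧
    γ = ε • gen (n, u) [a, b, c] ∧
    ((ty = 0 ∧ a = c ∧ op a b = c) ∨ (ty = 1 ∧ a = c ∧ op a b ≠ c) ∨
      (ty = 2 ∧ a ≠ c ∧ op a b = c) ∨ (ty = 3 ∧ a ≠ c ∧ op a b ≠ c))

/-- A bigon 3-term `⟨x, y⟩` of degree `n` and index `u`. -/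
def IsBigon (n : ℤ) (u x y : X) (δ : Ch X (ℤ × X)) : Prop :=
  δ = gen (n, u) [x, y, x] ∨ δ = gen (n, u) [y, x, y]

/-- The case shapes (A), (B), (C). -/
def Shape (δ : Ch X (ℤ × X)) (n : ℤ) (l : ℕ) : Prop :=
  (4 ≤ l ∧ l ≤ 7 ∧ Tcount δ n = l) ∨
  (6 ≤ l ∧ l ≤ 7 ∧ Tcount δ n = 2 ∧ Tcount δ (n + 1) = l - 2) ∨
  (6 ≤ l ∧ l ≤ 7 ∧ Tcount δ n = 3 ∧ Tcount δ (n + 1) = l - 3)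

/-- A quandle structure on `X`. -/
structure QuandleStr (X : Type*) where
  op : X → X → X
  idem : ∀ a, op a a = a
  bij : ∀ b, Function.Bijective fun a => op a b
  dist : ∀ a b c, op (op a b) c = op (op a c) (op b c)

/-- The dual quandle operation. -/
noncomputable def dualOp (Q : QuandleStr X) : X → X → X :=
  fun a b => (Equiv.ofBijective (fun x => Q.op x b) (Q.bij b)).symm a

/-- An `X`-set: a set with a right action of the associated group `G(X)`, recorded via its
action of the generators, which is bijective generator-wise and compatible with the
defining relations of `G(X)`. -/
structure QSet (X : Type*) (op : X → X → X) (S : Type*) where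
  sact : S → X → S
  bij : ∀ a, Function.Bijective fun s => sact s a
  comm : ∀ s a b, sact (sact s a) b = sact (sact s b) (op a b)

/-- The 7-dihedral quandle operation on `ZMod 7`. -/
def R7op : ZMod 7 → ZMod 7 → ZMod 7 := fun a b => 2 * b - a

def zetaInt (a b c : ℤ) : ℤ := (a - b) * ((b ^ 7 + (2 * c - b) ^ 7 - 2 * c ^ 7) / 7)

/-- The Mochizuki 3-cocycle on triples. -/
def zetaFun (a b c : ZMod 7) : ZMod 7 := (zetaInt a.val b.val c.val : ℤ)

def zetaL : List (ZMod 7) → ZMod 7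
  | [a, b, c] => zetaFun a b c
  | _ => 0

/-- The octahedral quandle operation on `Fin 6`: `octAct a b = σ_b(a)`. -/
def octAct : Fin 6 → Fin 6 → Fin 6 := fun a b =>
  ![![0, 2, 4, 3, 5, 1],
    ![5, 1, 0, 2, 4, 3],
    ![1, 3, 2, 4, 0, 5],
    ![0, 5, 1, 3, 2, 4],
    ![2, 1, 3, 5, 4, 0],
    ![4, 0, 2, 1, 3, 5]] b a

/-- `σ₀`, the rotation about the axis through `0` and `3`. -/
def sig0 : Fin 6 → Fin 6 := fun a => octAct a 0

def etaTriples1 : List (Fin 6 × Fin 6 × Fin 6) :=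
  [(0, 1, 2), (0, 3, 1), (1, 2, 0), (1, 4, 2), (3, 1, 5)]

def etaTriples2 : List (Fin 6 × Fin 6 × Fin 6) :=
  [(0, 1, 5), (1, 0, 1), (1, 0, 5), (1, 2, 1), (1, 3, 1), (1, 3, 2), (1, 4, 5), (1, 5, 1),
    (3, 0, 1), (3, 1, 0), (3, 1, 2)]

/-- The 3-cocycle `η` of the octahedral quandle, on triples. -/
noncomputable def etaFun (a b c : Fin 6) : ZMod 3 := by
  classical
  exact
    if ∃ k : ℕ, ∃ p ∈ etaTriples1, a = sig0^[k] p.1 ∧ b = sig0^[k] p.2.1 ∧ c = sig0^[k] p.2.2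
      then 1
    else if ∃ k : ℕ, ∃ p ∈ etaTriples2, a = sig0^[k] p.1 ∧ b = sig0^[k] p.2.1 ∧ c = sig0^[k] p.2.2
      then 2
    else 0

noncomputable def etaL : List (Fin 6) → ZMod 3
  | [a, b, c] => etaFun a b c
  | _ => 0

/-- The explicit 3-chain of `(R₇, ℤ × R₇)`. -/
noncomputable def gammaR7 : Ch (ZMod 7) (ℤ × ZMod 7) :=
  gen ((0 : ℤ), (0 : ZMod 7)) [0, 6, 1] - gen (1, 5) [5, 1, 4] - gen (0, 0) [1, 6, 0] +
    gen (1, 2) [6, 3, 0] + gen (0, 0) [0, 1, 6] - gen (1, 2) [2, 6, 3] -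
    gen (0, 0) [6, 1, 0] + gen (1, 5) [1, 4, 0]

/-! ### Evaluation by the kernel

The operations below are written with recursors and raw `Nat` functions so that the kernel
evaluates them quickly. -/

/-- Apply `k` to the evaluated form of `n`. -/
def forceNat {α : Type} (n : ℕ) (k : ℕ → α) : α :=
  Nat.rec (k 0) (fun m _ => k (Nat.succ m)) n

/-- Apply `k` to the list `l` after evaluating its spine. -/
def forceList {α : Type} (l : List ℕ) : (List ℕ → α) → α :=
  List.rec (fun k => k []) (fun x _ ih k => ih fun xs => k (x :: xs)) l

def select {α : Type} (b : Bool) (x y : α) : α := Bool.rec y x b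

def isNil (l : List ℕ) : Bool := List.rec true (fun _ _ _ => false) l

def anyOf (f : ℕ → Bool) (l : List ℕ) : Bool :=
  List.rec false (fun x _ ih => select (f x) true ih) l

def allOf (f : ℕ → Bool) (l : List ℕ) : Bool :=
  List.rec true (fun x _ ih => select (f x) ih false) l

@[simp] theorem forceNat_eq {α : Type} (n : ℕ) (k : ℕ → α) : forceNat n k = k n := by
  cases n <;> rfl

@[simp] theorem forceList_eq {α : Type} (l : List ℕ) (k : List ℕ → α) : forceList l k = k l := by
  induction l generalizing k with
  | nil => rfl
  | cons x l ih => exact ih fun xs => k (x :: xs)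

@[simp] theorem select_eq {α : Type} (b : Bool) (x y : α) :
    select b x y = if b = true then x else y := by
  cases b <;> rfl

@[simp] theorem isNil_iff (l : List ℕ) : isNil l = true ↔ l = [] := by
  cases l <;> simp [isNil]

theorem anyOf_iff (f : ℕ → Bool) (l : List ℕ) : anyOf f l = true ↔ ∃ x ∈ l, f x = true := by
  induction l with
  | nil => simp [anyOf]
  | cons x l ih =>
    change select (f x) true (anyOf f l) = true ↔ _
    rw [select_eq]
    split <;> simp_all

theorem allOf_iff (f : ℕ → Bool) (l : List ℕ) : allOf f l = true ↔ ∀ x ∈ l, f x = true := by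
  induction l with
  | nil => simp [allOf]
  | cons x l ih =>
    change select (f x) (allOf f l) false = true ↔ _
    rw [select_eq]
    split <;> simp_all

/-! ### Signed terms and signed faces

A signed term `±(u; a, b, c)` and a signed face `±(v; x, y)` of `(R₇, R₇)` are encoded as natural
numbers; the sign is the parity. -/

def encTerm (σ u a b c : ℕ) : ℕ :=
  Nat.add σ (Nat.add (Nat.mul 2 c) (Nat.add (Nat.mul 14 b)
    (Nat.add (Nat.mul 98 a) (Nat.mul 686 u))))

def encFace (σ v x y : ℕ) : ℕ :=
  Nat.add σ (Nat.add (Nat.mul 2 y) (Nat.add (Nat.mul 14 x) (Nat.mul 98 v)))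

def withTerm {α : Type} (τ : ℕ) (k : ℕ → ℕ → ℕ → ℕ → ℕ → α) : α :=
  forceNat (Nat.mod τ 2) fun σ => forceNat (Nat.div τ 686) fun u =>
  forceNat (Nat.mod (Nat.div τ 98) 7) fun a => forceNat (Nat.mod (Nat.div τ 14) 7) fun b =>
  forceNat (Nat.mod (Nat.div τ 2) 7) fun c => k σ u a b c

/-- The index of a signed term. -/
def ind (τ : ℕ) : ℕ := Nat.div τ 686

/-- The signed terms occurring in `f τ`. -/
def faces (τ : ℕ) : List ℕ :=
  withTerm τ fun σ u a b c =>
  encFace (Nat.sub 1 σ) u b c :: encFace (Nat.sub 1 σ) u a b ::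
    select (Nat.beq a c) [] [encFace σ u a c]

/-- Reversal of a signed term; it exchanges the roles of `f` and `g`. -/
def rho (τ : ℕ) : ℕ :=
  withTerm τ fun σ u a b c =>
  encTerm σ
    (Nat.mod (Nat.add (Nat.mul 2 a) (Nat.add (Nat.mul 5 b)
      (Nat.add (Nat.mul 2 c) (Nat.mul 6 u)))) 7)
    (Nat.mod (Nat.add a (Nat.add (Nat.mul 5 b) (Nat.mul 2 c))) 7)
    (Nat.mod (Nat.add (Nat.mul 2 c) (Nat.mul 6 b)) 7) c

/-- Change of sign. -/
def opp (s : ℕ) : ℕ := select (Nat.beq (Nat.mod s 2) 0) (Nat.succ s) (Nat.pred s)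

def candOf (σ v x y : ℕ) (l : List ℕ) : List ℕ :=
  List.rec [] (fun w _ l =>
    select (Nat.beq w x) (select (Nat.beq w y) l (encTerm σ v x y w :: l))
      (select (Nat.beq w y) (encTerm σ v w x y :: l)
        (encTerm σ v w x y :: encTerm σ v x y w :: encTerm (Nat.sub 1 σ) v x w y :: l))) l

/-- The signed terms one of whose faces is `opp s`. -/
def cand (s : ℕ) : List ℕ :=
  forceNat (Nat.mod s 2) fun σ => forceNat (Nat.div s 98) fun v =>
  forceNat (Nat.mod (Nat.div s 14) 7) fun x => forceNat (Nat.mod (Nat.div s 2) 7) fun y =>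
  candOf σ v x y [0, 1, 2, 3, 4, 5, 6]

/-- Add a signed face to a reduced list of signed faces. -/
def addFace (s : ℕ) (l : List ℕ) : List ℕ :=
  forceNat s fun s => forceNat (opp s) fun t =>
    List.rec [s] (fun x l ih => select (Nat.beq x t) l (x :: ih)) l

def addAll (l m : List ℕ) : List ℕ := List.rec m (fun s _ ih => addFace s ih) l

/-- The numbers of faces of the indices `0, …, 6`, as digits in base `32`. -/
def digits (l : List ℕ) : ℕ :=
  List.rec 0 (fun s _ n => Nat.add (Nat.pow 32 (Nat.div s 98)) n) l

def third (n : ℕ) : ℕ := Nat.div (Nat.add (Nat.mod n 32) 2) 3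

/-- A lower bound for the number of terms needed to cancel the faces in `l`. -/
def need (l : List ℕ) : ℕ :=
  forceNat (digits l) fun n =>
  Nat.add (third n) (Nat.add (third (Nat.div n 32)) (Nat.add (third (Nat.div n 1024))
    (Nat.add (third (Nat.div n 32768)) (Nat.add (third (Nat.div n 1048576))
    (Nat.add (third (Nat.div n 33554432)) (third (Nat.div n 1073741824)))))))

/-- The best face of `l` to branch on, packed with its score and the tag `b`. -/
def bestFace (b : ℕ) (l : List ℕ) (init : ℕ) : ℕ :=
  forceNat (digits l) fun n =>
  List.rec init (fun s _ m =>
    forceNat (Nat.mod (Nat.div n (Nat.pow 32 (Nat.div s 98))) 32) fun k =>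
    forceNat (Nat.add (Nat.mul (Nat.add (Nat.mul 2 (Nat.add
      (Nat.mul 16 (Nat.mod (Nat.sub 3 (Nat.mod k 3)) 3)) k)) b) 2048) s) fun x =>
    forceNat m fun m => select (Nat.ble x m) x m) l

def pickG (F G : List ℕ) : ℕ :=
  select (isNil G) (bestFace 0 F 1000000) (bestFace 1 G 1000000)

def pickF (F G : List ℕ) : ℕ :=
  select (isNil F) (bestFace 1 G 1000000) (bestFace 0 F 1000000)

/-- Search for the chains `M` with at most `r` terms satisfying `p` for which `f M` cancels `F` and
`f (ρ M)` cancels `G`; every solution, together with `L`, has to pass the test `ok`. -/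
def search (pk : List ℕ → List ℕ → ℕ) (ok : List ℕ → Bool) (p : ℕ → Bool) (r : ℕ) :
    List ℕ → List ℕ → List ℕ → Bool :=
  Nat.rec (fun F G L => select (isNil F) (select (isNil G) (ok L) true) true)
  (fun r ih F G L =>
    select (select (isNil F) (isNil G) false) (ok L) <|
    forceNat (pk F G) fun x => forceNat (Nat.mod x 2048) fun s =>
    select (Nat.beq (Nat.mod (Nat.div x 2048) 2) 0)
      (select (anyOf (Nat.beq s) F) (allOf (fun τ => forceNat τ fun τ =>
        select (p τ)
        (forceList (addAll (faces τ) F) fun F' => select (Nat.ble (need F') r)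
          (forceList (addAll (faces (rho τ)) G) fun G' =>
          select (Nat.ble (need G') r) (ih F' G' (τ :: L)) true) true) true) (cand s)) false)
      (select (anyOf (Nat.beq s) G) (allOf (fun τ' => forceNat τ' fun τ' =>
        forceNat (rho τ') fun τ =>
        select (p τ)
        (forceList (addAll (faces τ') G) fun G' => select (Nat.ble (need G') r)
          (forceList (addAll (faces τ) F) fun F' =>
          select (Nat.ble (need F') r) (ih F' G' (τ :: L)) true) true) true) (cand s)) false)) r

/-- Like `search`, without the condition involving `ρ`. -/
def fill (ok : List ℕ → Bool) (p : ℕ → Bool) (r : ℕ) : List ℕ → List ℕ → Bool :=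
  Nat.rec (fun F L => select (isNil F) (ok L) true)
  (fun r ih F L =>
    List.rec (ok L) (fun s _ _ => allOf (fun τ => forceNat τ fun τ =>
      select (p τ)
      (forceList (addAll (faces τ) F) fun F' => select (Nat.ble (need F') r)
        (ih F' (τ :: L)) true) true) (cand s)) F) r

/-- The `f`-faces of the chain `L`. -/
def facesF (L : List ℕ) : List ℕ := List.rec [] (fun τ _ ih => addAll (faces τ) ih) L

/-- The `f`-faces of the reverse of the chain `L`. -/
def facesG (L : List ℕ) : List ℕ := List.rec [] (fun τ _ ih => addAll (faces (rho τ)) ih) L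

/-- The reversal of signed faces. -/
def kap (s : ℕ) : ℕ :=
  forceNat (Nat.div s 98) fun v => forceNat (Nat.mod (Nat.div s 14) 7) fun x =>
  forceNat (Nat.mod (Nat.div s 2) 7) fun y =>
  encFace (Nat.mod s 2) (Nat.mod (Nat.add v (Nat.add (Nat.mul 2 y) (Nat.mul 5 x))) 7)
    (Nat.mod (Nat.add (Nat.mul 2 y) (Nat.mul 6 x)) 7) y

/-- The signed terms of `g L`. -/
def gFaces (L : List ℕ) : List ℕ := (facesG L).map fun s => opp (kap s)

/-- The value of `ζ` on the translate by `j` of a signed term. -/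
def zetaNat (j τ : ℕ) : ℕ :=
  withTerm τ fun σ _ a b c =>
  (if σ = 0 then 1 else 6) * ((a + 7 - b) * (2 * (3 * (c + j) ^ 5 * (b + 7 - c) ^ 2 +
    5 * (c + j) ^ 3 * (b + 7 - c) ^ 4 + (c + j) * (b + 7 - c) ^ 6)))

def zetaSum (j : ℕ) (L : List ℕ) : ℕ := List.rec 0 (fun τ _ n => zetaNat j τ + n) L

def zetaTest (L : List ℕ) : Bool :=
  allOf (fun j => select (Nat.beq (zetaSum j L % 7) 0)
    (Nat.beq (zetaSum j (L.map rho) % 7) 0) false) [0, 1, 2, 3, 4, 5, 6]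

def atLeastTwo (L : List ℕ) : Bool := Nat.ble 2 L.length

/-- No nonzero closed chain of one degree and length at most `7` contains the closed chain `L` as
its part of index `u`. -/
def testSingle (u : ℕ) (L : List ℕ) : Bool :=
  select (atLeastTwo L) (forceList (facesG L) fun G =>
    search pickG (fun _ => false) (fun τ => !(Nat.beq (ind τ) u)) (7 - L.length) [] G []) false

/-- A cycle of length at most `7` with lowest part `L` is killed by `ζ`. -/
def testDouble (L : List ℕ) : Bool :=
  select (atLeastTwo L) (forceList (gFaces L) fun F =>
    select (fill (fun _ => false) (fun _ => true) (5 - L.length) F [])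
      (search pickF (fun K => zetaTest (K ++ L)) (fun _ => true) (7 - L.length) F [] []) false)
    false

def excludes (τ x : ℕ) : Bool := !(Nat.beq x (opp τ))

/-- Run `test` on all closed chains of length at most `3` containing `(u; 0, 1, 0)`. -/
def testStart (test : List ℕ → Bool) (u : ℕ) : Bool :=
  forceNat (encTerm 0 u 0 1 0) fun τ =>
    forceList (facesF [τ]) fun F => fill test (excludes τ) 2 F [τ]

/-- There are no closed chains of length at most `3` containing `(u; 0, 1, c)` and no term
`(u; a, b, a)`. -/
def testNoBigon (u c : ℕ) : Bool :=
  forceNat (encTerm 0 u 0 1 c) fun τ =>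
    forceList (facesF [τ]) fun F =>
      fill (fun _ => false) (fun x => withTerm x fun _ _ a _ c =>
        select (Nat.beq a c) false (excludes τ x)) 2 F [τ]

/-- A nonzero closed chain of length at most `7` with one index, whose reverse has one index,
cannot contain `(u; 0, 1, c)`. -/
def testCell (u c : ℕ) : Bool :=
  forceNat (encTerm 0 u 0 1 c) fun τ => forceNat (ind (rho τ)) fun v =>
    forceList (facesF [τ]) fun F => forceList (facesG [τ]) fun G =>
      search pickG (fun _ => false) (fun x => select (Nat.beq (ind x) u)
        (select (Nat.beq (ind (rho x)) v) (excludes τ x) false) false) 6 F G []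

set_option maxRecDepth 20000 in
theorem testStart_testSingle :
    allOf (fun u => testStart (testSingle u) u) [0, 1, 2, 3, 4, 5, 6] = true := by
  decide +kernel

set_option maxRecDepth 20000 in
theorem testStart_testDouble : allOf (testStart testDouble) [0, 1, 2, 3, 4, 5, 6] = true := by
  decide +kernel

set_option maxRecDepth 20000 in
theorem testNoBigon_true :
    allOf (fun u => allOf (testNoBigon u) [2, 3, 4, 5, 6]) [0, 1, 2, 3, 4, 5, 6] = true := by
  decide +kernel

set_option maxRecDepth 20000 in
theorem testCell_true :
    allOf (fun u => allOf (testCell u) [0, 2, 3, 4, 5, 6]) [0, 1, 2, 3, 4, 5, 6] = true := by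
  decide +kernel

/-! ### Arithmetic of the encodings -/

theorem encTerm_eq (σ u a b c : ℕ) :
    encTerm σ u a b c = σ + (2 * c + (14 * b + (98 * a + 686 * u))) := rfl

theorem encFace_eq (σ v x y : ℕ) : encFace σ v x y = σ + (2 * y + (14 * x + 98 * v)) := rfl

theorem withTerm_eq {α : Type} (τ : ℕ) (k : ℕ → ℕ → ℕ → ℕ → ℕ → α) :
    withTerm τ k = k (τ % 2) (τ / 686) (τ / 98 % 7) (τ / 14 % 7) (τ / 2 % 7) := by
  simp only [withTerm, forceNat_eq]
  rfl

theorem withTerm_encTerm {α : Type} (k : ℕ → ℕ → ℕ → ℕ → ℕ → α) {σ a b c : ℕ} (u : ℕ)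
    (hσ : σ < 2) (ha : a < 7) (hb : b < 7) (hc : c < 7) :
    withTerm (encTerm σ u a b c) k = k σ u a b c := by
  rw [withTerm_eq, encTerm_eq]
  congr 1 <;> omega

theorem opp_eq (s : ℕ) : opp s = if s % 2 = 0 then s + 1 else s - 1 := by
  simp only [opp, select_eq, Nat.beq_eq]
  rfl

theorem opp_opp (s : ℕ) : opp (opp s) = s := by
  simp only [opp_eq]
  split_ifs <;> omega

theorem opp_ne (s : ℕ) : opp s ≠ s := by
  simp only [opp_eq]
  split_ifs <;> omega

theorem opp_encTerm {σ : ℕ} (u a b c : ℕ) (hσ : σ < 2) :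
    opp (encTerm σ u a b c) = encTerm (1 - σ) u a b c := by
  simp only [opp_eq, encTerm_eq]
  split_ifs <;> omega

theorem opp_encFace {σ : ℕ} (v x y : ℕ) (hσ : σ < 2) :
    opp (encFace σ v x y) = encFace (1 - σ) v x y := by
  simp only [opp_eq, encFace_eq]
  split_ifs <;> omega

/-- `τ` encodes a signed generator of length three. -/
def Valid (τ : ℕ) : Prop :=
  ∃ σ u a b c, σ < 2 ∧ u < 7 ∧ a < 7 ∧ b < 7 ∧ c < 7 ∧ a ≠ b ∧ b ≠ c ∧ τ = encTerm σ u a b c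

theorem valid_encTerm {σ u a b c : ℕ} (hσ : σ < 2) (hu : u < 7) (ha : a < 7) (hb : b < 7)
    (hc : c < 7) (hab : a ≠ b) (hbc : b ≠ c) : Valid (encTerm σ u a b c) :=
  ⟨σ, u, a, b, c, hσ, hu, ha, hb, hc, hab, hbc, rfl⟩

theorem faces_encTerm {σ a b c : ℕ} (u : ℕ) (hσ : σ < 2) (ha : a < 7) (hb : b < 7) (hc : c < 7) :
    faces (encTerm σ u a b c) = encFace (1 - σ) u b c :: encFace (1 - σ) u a b ::
      if a = c then [] else [encFace σ u a c] := by
  rw [faces, withTerm_encTerm _ u hσ ha hb hc]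
  simp only [select_eq, Nat.beq_eq]
  rfl

theorem rho_encTerm {σ a b c : ℕ} (u : ℕ) (hσ : σ < 2) (ha : a < 7) (hb : b < 7) (hc : c < 7) :
    rho (encTerm σ u a b c) = encTerm σ ((2 * a + (5 * b + (2 * c + 6 * u))) % 7)
      ((a + (5 * b + 2 * c)) % 7) ((2 * c + 6 * b) % 7) c := by
  rw [rho, withTerm_encTerm _ u hσ ha hb hc]
  rfl

theorem ind_encTerm {σ a b c : ℕ} (u : ℕ) (hσ : σ < 2) (ha : a < 7) (hb : b < 7) (hc : c < 7) :
    ind (encTerm σ u a b c) = u := by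
  change (encTerm σ u a b c) / 686 = u
  rw [encTerm_eq]
  omega

theorem Valid.opp {τ : ℕ} (h : Valid τ) : Valid (opp τ) := by
  obtain ⟨σ, u, a, b, c, hσ, hu, ha, hb, hc, hab, hbc, rfl⟩ := h
  rw [opp_encTerm _ _ _ _ hσ]
  exact valid_encTerm (by omega) hu ha hb hc hab hbc

theorem Valid.rho {τ : ℕ} (h : Valid τ) : Valid (rho τ) := by
  obtain ⟨σ, u, a, b, c, hσ, hu, ha, hb, hc, hab, hbc, rfl⟩ := h
  rw [rho_encTerm u hσ ha hb hc]
  exact valid_encTerm hσ (by omega) (by omega) (by omega) hc (by omega) (by omega)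

theorem rho_rho {τ : ℕ} (h : Valid τ) : QHom.rho (QHom.rho τ) = τ := by
  obtain ⟨σ, u, a, b, c, hσ, hu, ha, hb, hc, hab, hbc, rfl⟩ := h
  rw [rho_encTerm u hσ ha hb hc, rho_encTerm _ hσ (by omega) (by omega) hc]
  congr 1 <;> omega

theorem rho_opp {τ : ℕ} (h : Valid τ) : QHom.rho (QHom.opp τ) = QHom.opp (QHom.rho τ) := by
  obtain ⟨σ, u, a, b, c, hσ, hu, ha, hb, hc, hab, hbc, rfl⟩ := h
  rw [opp_encTerm _ _ _ _ hσ, rho_encTerm u hσ ha hb hc, opp_encTerm _ _ _ _ hσ,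
    rho_encTerm u (by omega) ha hb hc]

theorem ind_opp {τ : ℕ} (h : Valid τ) : ind (QHom.opp τ) = ind τ := by
  obtain ⟨σ, u, a, b, c, hσ, hu, ha, hb, hc, hab, hbc, rfl⟩ := h
  rw [opp_encTerm _ _ _ _ hσ, ind_encTerm u hσ ha hb hc, ind_encTerm u (by omega) ha hb hc]

theorem ind_lt {τ : ℕ} (h : Valid τ) : ind τ < 7 := by
  obtain ⟨σ, u, a, b, c, hσ, hu, ha, hb, hc, hab, hbc, rfl⟩ := h
  rwa [ind_encTerm u hσ ha hb hc]

theorem face_index {τ s : ℕ} (h : Valid τ) (hs : s ∈ faces τ) : s / 98 = ind τ := by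
  obtain ⟨σ, u, a, b, c, hσ, hu, ha, hb, hc, hab, hbc, rfl⟩ := h
  rw [faces_encTerm u hσ ha hb hc] at hs
  rw [ind_encTerm u hσ ha hb hc]
  split_ifs at hs <;> simp only [List.mem_cons, List.not_mem_nil, or_false, encFace_eq] at hs <;>
    omega

theorem faces_opp {τ : ℕ} (h : Valid τ) : faces (QHom.opp τ) = (faces τ).map QHom.opp := by
  obtain ⟨σ, u, a, b, c, hσ, hu, ha, hb, hc, hab, hbc, rfl⟩ := h
  rw [opp_encTerm _ _ _ _ hσ, faces_encTerm u hσ ha hb hc, faces_encTerm u (by omega) ha hb hc]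
  split_ifs <;>
    simp [opp_encFace _ _ _ (show 1 - σ < 2 by omega), opp_encFace _ _ _ hσ]

theorem mem_candOf {σ v x y w : ℕ} {l : List ℕ} (hw : w ∈ l) :
    (w ≠ x → encTerm σ v w x y ∈ candOf σ v x y l) ∧
    (w ≠ y → encTerm σ v x y w ∈ candOf σ v x y l) ∧
    (w ≠ x → w ≠ y → encTerm (1 - σ) v x w y ∈ candOf σ v x y l) := by
  induction l with
  | nil => simp at hw
  | cons z l ih =>
    have key : candOf σ v x y (z :: l) =
        select (Nat.beq z x) (select (Nat.beq z y) (candOf σ v x y l)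
          (encTerm σ v x y z :: candOf σ v x y l))
        (select (Nat.beq z y) (encTerm σ v z x y :: candOf σ v x y l)
        (encTerm σ v z x y :: encTerm σ v x y z :: encTerm (1 - σ) v x z y ::
          candOf σ v x y l)) := rfl
    rw [key]
    simp only [select_eq, Nat.beq_eq]
    rcases List.mem_cons.1 hw with rfl | hw
    · split_ifs with h1 h2 h2 <;> refine ⟨fun h => ?_, fun h => ?_, fun h h' => ?_⟩ <;> simp_all
    · obtain ⟨i1, i2, i3⟩ := ih hw
      split_ifs <;> exact ⟨fun h => by simp [i1 h], fun h => by simp [i2 h],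
        fun h h' => by simp [i3 h h']⟩

theorem mem_cand {τ s : ℕ} (h : Valid τ) (hs : opp s ∈ faces τ) : τ ∈ cand s := by
  obtain ⟨σ, u, a, b, c, hσ, hu, ha, hb, hc, hab, hbc, rfl⟩ := h
  have key : ∀ {e v x y : ℕ}, e < 2 → x < 7 → y < 7 → opp s = encFace e v x y →
      cand s = candOf (1 - e) v x y [0, 1, 2, 3, 4, 5, 6] := by
    intro e v x y he hx hy h
    have h' : s = encFace (1 - e) v x y := by rw [← opp_encFace _ _ _ he, ← h, opp_opp]
    simp only [cand, forceNat_eq]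
    change candOf (s % 2) (s / 98) (s / 14 % 7) (s / 2 % 7) _ = _
    rw [encFace_eq] at h'
    congr 1 <;> omega
  have mem7 : ∀ {w : ℕ}, w < 7 → w ∈ [0, 1, 2, 3, 4, 5, 6] := by
    intro w hw
    simp only [List.mem_cons, List.not_mem_nil, or_false]
    omega
  rw [faces_encTerm u hσ ha hb hc] at hs
  have hσ' : 1 - (1 - σ) = σ := by omega
  split_ifs at hs with hac <;> simp only [List.mem_cons, List.not_mem_nil, or_false] at hs
  · rcases hs with hs | hs
    · rw [key (by omega) hb hc hs, hσ']
      exact (mem_candOf (mem7 ha)).1 hab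
    · rw [key (by omega) ha hb hs, hσ']
      exact (mem_candOf (mem7 hc)).2.1 hbc.symm
  · rcases hs with hs | hs | hs
    · rw [key (by omega) hb hc hs, hσ']
      exact (mem_candOf (mem7 ha)).1 hab
    · rw [key (by omega) ha hb hs, hσ']
      exact (mem_candOf (mem7 hc)).2.1 hbc.symm
    · rw [key (by omega) ha hc hs]
      have := (mem_candOf (σ := 1 - σ) (v := u) (x := a) (y := c) (mem7 hb)).2.2 hab.symm hbc
      rwa [hσ'] at this

/-! ### Signed faces as elements of a free abelian group -/

/-- The element of the free abelian group encoded by a signed face. -/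
noncomputable def sv (s : ℕ) : ℕ →₀ ℤ := Finsupp.single (s / 2) (if s % 2 = 0 then 1 else -1)

noncomputable def val (l : List ℕ) : ℕ →₀ ℤ := (l.map sv).sum

/-- The boundary `f` of a signed term. -/
noncomputable def fv (τ : ℕ) : ℕ →₀ ℤ := val (faces τ)

/-- The boundary `f` of a chain, given as a multiset of signed terms. -/
noncomputable def Fm (M : Multiset ℕ) : ℕ →₀ ℤ := (M.map fv).sum

theorem sv_opp (s : ℕ) : sv (opp s) = -sv s := by
  rw [sv, sv, ← Finsupp.single_neg, opp_eq]
  split_ifs <;> first | omega | (congr 1; omega)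

@[simp] theorem val_nil : val [] = 0 := rfl

@[simp] theorem val_cons (s : ℕ) (l : List ℕ) : val (s :: l) = sv s + val l := by
  simp [val]

theorem val_map_opp (l : List ℕ) : val (l.map opp) = -val l := by
  induction l with
  | nil => simp
  | cons s l ih => rw [List.map_cons, val_cons, val_cons, ih, sv_opp, neg_add]

theorem fv_opp {τ : ℕ} (h : Valid τ) : fv (opp τ) = -fv τ := by
  rw [fv, faces_opp h, val_map_opp, fv]

@[simp] theorem Fm_zero : Fm 0 = 0 := rfl

@[simp] theorem Fm_cons (τ : ℕ) (M : Multiset ℕ) : Fm (τ ::ₘ M) = fv τ + Fm M := by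
  simp [Fm]

@[simp] theorem Fm_add (M N : Multiset ℕ) : Fm (M + N) = Fm M + Fm N := by
  simp [Fm]

/-- A list of signed faces is reduced if nothing cancels in it. -/
def Red (l : List ℕ) : Prop := ∀ x ∈ l, opp x ∉ l

theorem red_nil : Red [] := by simp [Red]

theorem addFace_nil (s : ℕ) : addFace s [] = [s] := by
  simp [addFace]

theorem addFace_cons (s x : ℕ) (l : List ℕ) :
    addFace s (x :: l) = if x = opp s then l else x :: addFace s l := by
  simp only [addFace, forceNat_eq, select_eq, Nat.beq_eq]

theorem mem_addFace {s y : ℕ} {l : List ℕ} (h : y ∈ addFace s l) : y = s ∨ y ∈ l := by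
  induction l with
  | nil => simpa [addFace_nil] using h
  | cons x l ih =>
    rw [addFace_cons] at h
    split_ifs at h
    · exact Or.inr (List.mem_cons_of_mem _ h)
    · rcases List.mem_cons.1 h with rfl | h
      · simp
      · rcases ih h with h | h <;> simp [h]

theorem Red.addFace {l : List ℕ} (h : Red l) (s : ℕ) : Red (addFace s l) := by
  induction l with
  | nil =>
    intro x hx
    simp only [addFace_nil, List.mem_singleton] at hx ⊢
    rw [hx]
    exact opp_ne s
  | cons y l ih =>
    have hl : Red l := fun x hx hx' => h x (by simp [hx]) (by simp [hx'])
    rw [addFace_cons]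
    split_ifs with hy
    · exact hl
    · intro x hx hx'
      rcases List.mem_cons.1 hx with rfl | hx <;> rcases List.mem_cons.1 hx' with hx' | hx'
      · exact opp_ne _ hx'
      · rcases mem_addFace hx' with e | e
        · exact hy (by rw [← e, opp_opp])
        · exact h x (by simp) (by simp [e])
      · rcases mem_addFace hx with e | e
        · exact hy (by rw [← e, hx'])
        · exact h x (by simp [e]) (by simp [hx'])
      · exact ih hl x hx hx'

theorem val_addFace (s : ℕ) (l : List ℕ) : val (addFace s l) = sv s + val l := by
  induction l with
  | nil => simp [addFace_nil]
  | cons y l ih =>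
    rw [addFace_cons]
    split_ifs with hy
    · simp [hy, sv_opp]
    · rw [val_cons, val_cons, ih]
      abel

theorem Red.addAll {m : List ℕ} (h : Red m) (l : List ℕ) : Red (addAll l m) := by
  induction l with
  | nil => exact h
  | cons s l ih => exact ih.addFace s

theorem val_addAll (l m : List ℕ) : val (addAll l m) = val l + val m := by
  induction l with
  | nil => simp [QHom.addAll]
  | cons s l ih =>
    change val (QHom.addFace s (QHom.addAll l m)) = _
    rw [val_addFace, ih, val_cons, add_assoc]

theorem red_facesF (L : List ℕ) : Red (facesF L) := by
  induction L with
  | nil => exact red_nil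
  | cons τ L ih => exact ih.addAll _

theorem red_facesG (L : List ℕ) : Red (facesG L) := by
  induction L with
  | nil => exact red_nil
  | cons τ L ih => exact ih.addAll _

theorem val_facesF (L : List ℕ) : val (facesF L) = Fm L := by
  induction L with
  | nil => rfl
  | cons τ L ih =>
    rw [← Multiset.cons_coe, Fm_cons, ← ih]
    exact val_addAll _ _

theorem val_facesG (L : List ℕ) : val (facesG L) = Fm (Multiset.map rho L) := by
  induction L with
  | nil => rfl
  | cons τ L ih =>
    rw [← Multiset.cons_coe, Multiset.map_cons, Fm_cons, ← ih]
    exact val_addAll _ _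

/-! ### Counting faces -/

/-- The coefficient of the signed face `s`. -/
noncomputable def coeffAt (s : ℕ) : (ℕ →₀ ℤ) →+ ℤ :=
  (AddMonoidHom.mulLeft (if s % 2 = 0 then 1 else -1)).comp (Finsupp.applyAddHom (s / 2))

theorem coeffAt_sv (s x : ℕ) :
    coeffAt s (sv x) = (if s = x then 1 else 0) - if opp s = x then 1 else 0 := by
  change (if s % 2 = 0 then (1 : ℤ) else -1) * (sv x) (s / 2) = _
  rw [sv, Finsupp.single_apply, opp_eq]
  split_ifs <;> omega

theorem coeffAt_sum (s : ℕ) (B : Multiset ℕ) :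
    coeffAt s (B.map sv).sum = B.count s - B.count (opp s) := by
  induction B using Multiset.induction with
  | empty => simp
  | cons x B ih =>
    rw [Multiset.map_cons, Multiset.sum_cons, map_add, ih, coeffAt_sv, Multiset.count_cons,
      Multiset.count_cons]
    push_cast
    ring

theorem Fm_eq_sum (M : Multiset ℕ) :
    Fm M = ((M.bind fun τ => (faces τ : Multiset ℕ)).map sv).sum := by
  induction M using Multiset.induction with
  | empty => simp
  | cons τ M ih =>
    rw [Fm_cons, Multiset.cons_bind, Multiset.map_add, Multiset.sum_add, ih, fv, val]
    simp

theorem map_opp_le_bind {F : List ℕ} {M : Multiset ℕ} (hF : Red F) (h : val F + Fm M = 0) :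
    (F.map opp : Multiset ℕ) ≤ M.bind fun τ => (faces τ : Multiset ℕ) := by
  rw [Multiset.le_iff_count]
  intro a
  have h1 : Multiset.count a (F.map opp : Multiset ℕ) =
      Multiset.count (opp a) (F : Multiset ℕ) := by
    conv_lhs => rw [← opp_opp a]
    rw [← Multiset.map_coe]
    exact Multiset.count_map_eq_count' _ _ (Function.LeftInverse.injective opp_opp) _
  rw [h1]
  by_cases ha : opp a ∈ F
  · have h2 := congrArg (coeffAt (opp a)) h
    have h3 : val F = ((F : Multiset ℕ).map sv).sum := by simp [val]
    have h4 : Multiset.count a (F : Multiset ℕ) = 0 := by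
      rw [Multiset.count_eq_zero]
      have := hF _ ha
      rwa [opp_opp] at this
    rw [map_add, h3, Fm_eq_sum, coeffAt_sum, coeffAt_sum, opp_opp, h4, map_zero] at h2
    omega
  · rw [Multiset.count_eq_zero.2 (by simpa using ha)]
    exact Nat.zero_le _

theorem eq_nil_of_val_eq_zero {F : List ℕ} (hF : Red F) (h : val F = 0) : F = [] := by
  have := map_opp_le_bind (M := 0) hF (by simpa using h)
  simpa using this

theorem exists_mem_cand {F : List ℕ} {M : Multiset ℕ} (hF : Red F) (h : val F + Fm M = 0)
    (hM : ∀ τ ∈ M, Valid τ) {s : ℕ} (hs : s ∈ F) : ∃ τ ∈ M, τ ∈ cand s := by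
  have h1 : opp s ∈ (F.map opp : Multiset ℕ) := by
    rw [Multiset.mem_coe]
    exact List.mem_map_of_mem hs
  obtain ⟨τ, hτ, h2⟩ := Multiset.mem_bind.1 (Multiset.mem_of_le (map_opp_le_bind hF h) h1)
  exact ⟨τ, hτ, mem_cand (hM τ hτ) (Multiset.mem_coe.1 h2)⟩

theorem faces_length_le (τ : ℕ) : (faces τ).length ≤ 3 := by
  rw [faces, withTerm_eq]
  simp only [select_eq]
  split_ifs <;> simp

theorem countP_bind_le {M : Multiset ℕ} (hM : ∀ τ ∈ M, Valid τ) (v : ℕ) :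
    (M.bind fun τ => (faces τ : Multiset ℕ)).countP (fun s => s / 98 = v) ≤
      3 * M.countP (fun τ => ind τ = v) := by
  induction M using Multiset.induction with
  | empty => simp
  | cons τ M ih =>
    rw [Multiset.cons_bind, Multiset.countP_add, Multiset.countP_cons]
    have h1 := ih fun τ hτ => hM τ (Multiset.mem_cons_of_mem hτ)
    split_ifs with h
    · have h2 := (Multiset.countP_le_card (fun s => s / 98 = v) (faces τ : Multiset ℕ)).trans
        (faces_length_le τ)
      omega
    · rw [Multiset.countP_eq_zero.2 fun s hs hs' =>
        h ((face_index (hM τ (Multiset.mem_cons_self _ _)) (Multiset.mem_coe.1 hs)).symm.trans hs')]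
      omega

theorem card_eq_countP {M : Multiset ℕ} (hM : ∀ τ ∈ M, Valid τ) :
    Multiset.card M = ∑ v ∈ Finset.range 7, M.countP (fun τ => ind τ = v) := by
  induction M using Multiset.induction with
  | empty => simp
  | cons τ M ih =>
    have h := ind_lt (hM τ (Multiset.mem_cons_self _ _))
    simp only [Multiset.countP_cons, Finset.sum_add_distrib, Multiset.card_cons]
    rw [ih fun τ hτ => hM τ (Multiset.mem_cons_of_mem hτ), Finset.sum_ite_eq]
    simp [h]

theorem digits_eq {F : List ℕ} (hF : ∀ s ∈ F, s / 98 < 7) :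
    digits F = ∑ v ∈ Finset.range 7, 32 ^ v * (F : Multiset ℕ).countP (fun s => s / 98 = v) := by
  induction F with
  | nil => simp [digits]
  | cons s F ih =>
    have h := hF s (by simp)
    have key : digits (s :: F) = 32 ^ (s / 98) + digits F := rfl
    rw [key, ih fun s hs => hF s (by simp [hs]), ← Multiset.cons_coe]
    simp only [Multiset.countP_cons, mul_add, Finset.sum_add_distrib, mul_ite, mul_one, mul_zero]
    rw [Finset.sum_ite_eq]
    simp [h, add_comm]

theorem third_eq (n : ℕ) : third n = (n % 32 + 2) / 3 := rfl

theorem third_of_eq {n k m : ℕ} (h : n = k + 32 * m) (hk : k ≤ 21) :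
    third n = (k + 2) / 3 ∧ n / 32 = m := by
  rw [third_eq]
  omega

theorem horner {k₀ k₁ k₂ k₃ k₄ k₅ k₆ : ℕ} :
    0 + 32 ^ 0 * k₀ + 32 ^ 1 * k₁ + 32 ^ 2 * k₂ + 32 ^ 3 * k₃ + 32 ^ 4 * k₄ + 32 ^ 5 * k₅ +
        32 ^ 6 * k₆ =
      k₀ + 32 * (k₁ + 32 * (k₂ + 32 * (k₃ + 32 * (k₄ + 32 * (k₅ + 32 * (k₆ + 32 * 0)))))) := by
  ring

theorem need_le {F : List ℕ} {M : Multiset ℕ} (hF : Red F) (h : val F + Fm M = 0)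
    (hM : ∀ τ ∈ M, Valid τ) (h7 : Multiset.card M ≤ 7) : need F ≤ Multiset.card M := by
  have hle := map_opp_le_bind hF h
  have hdiv : ∀ s, opp s / 98 = s / 98 := by
    intro s
    rw [opp_eq]
    split_ifs <;> omega
  have hidx : ∀ s ∈ F, s / 98 < 7 := by
    intro s hs
    have h1 : opp s ∈ (F.map opp : Multiset ℕ) := by
      rw [Multiset.mem_coe]
      exact List.mem_map_of_mem hs
    obtain ⟨τ, hτ, h2⟩ := Multiset.mem_bind.1 (Multiset.mem_of_le hle h1)
    rw [← hdiv, face_index (hM τ hτ) (Multiset.mem_coe.1 h2)]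
    exact ind_lt (hM τ hτ)
  have hcount : ∀ v, (F : Multiset ℕ).countP (fun s => s / 98 = v) ≤
      3 * M.countP (fun τ => ind τ = v) := by
    intro v
    refine le_trans (le_of_eq ?_) ((Multiset.countP_le_of_le _ hle).trans (countP_bind_le hM v))
    rw [← Multiset.map_coe, Multiset.countP_map, ← Multiset.countP_eq_card_filter]
    simp only [hdiv]
  have hcard := card_eq_countP hM
  have hdig := digits_eq hidx
  simp only [Finset.sum_range_succ, Finset.sum_range_zero] at hcard hdig
  have hneed : need F = third (digits F) + (third (digits F / 32) + (third (digits F / 1024) +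
      (third (digits F / 32768) + (third (digits F / 1048576) +
      (third (digits F / 33554432) + third (digits F / 1073741824)))))) := by
    simp only [need, forceNat_eq]
    rfl
  have c0 := hcount 0
  have c1 := hcount 1
  have c2 := hcount 2
  have c3 := hcount 3
  have c4 := hcount 4
  have c5 := hcount 5
  have c6 := hcount 6
  obtain ⟨t0, d0⟩ := third_of_eq (hdig.trans horner) (by omega)
  obtain ⟨t1, d1⟩ := third_of_eq d0 (by omega)
  obtain ⟨t2, d2⟩ := third_of_eq d1 (by omega)
  obtain ⟨t3, d3⟩ := third_of_eq d2 (by omega)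
  obtain ⟨t4, d4⟩ := third_of_eq d3 (by omega)
  obtain ⟨t5, d5⟩ := third_of_eq d4 (by omega)
  obtain ⟨t6, -⟩ := third_of_eq (m := 0) d5 (by omega)
  simp only [Nat.div_div_eq_div_mul, Nat.reduceMul] at t1 t2 t3 t4 t5 t6
  rw [hneed, t0, t1, t2, t3, t4, t5, t6]
  omega
/-! ### Soundness of the searches -/

theorem val_addAll_faces {F : List ℕ} {τ : ℕ} {M : Multiset ℕ} (h : val F + Fm (τ ::ₘ M) = 0) :
    val (addAll (faces τ) F) + Fm M = 0 := by
  rw [Fm_cons] at h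
  rw [val_addAll, ← h, fv]
  abel

theorem fill_succ_cons {ok : List ℕ → Bool} {p : ℕ → Bool} {r s : ℕ} {F L : List ℕ}
    (h : fill ok p (r + 1) (s :: F) L = true) : ∀ τ ∈ cand s, p τ = true →
      need (addAll (faces τ) (s :: F)) ≤ r →
        fill ok p r (addAll (faces τ) (s :: F)) (τ :: L) = true := by
  intro τ hτ hp hn
  change allOf (fun τ => forceNat τ fun τ => select (p τ)
    (forceList (addAll (faces τ) (s :: F)) fun F' => select (Nat.ble (need F') r)
      (fill ok p r F' (τ :: L)) true) true) (cand s) = true at h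
  have h1 := (allOf_iff _ _).1 h τ hτ
  simp only [forceNat_eq, select_eq, forceList_eq, hp, if_true, Nat.ble_eq] at h1
  rwa [if_pos hn] at h1

theorem search_succ {pk : List ℕ → List ℕ → ℕ} {ok : List ℕ → Bool} {p : ℕ → Bool} {r : ℕ}
    {F G L : List ℕ} (h : search pk ok p (r + 1) F G L = true) :
    (F = [] ∧ G = [] ∧ ok L = true) ∨
    (∃ s ∈ F, ∀ τ ∈ cand s, p τ = true →
      need (addAll (faces τ) F) ≤ r → need (addAll (faces (rho τ)) G) ≤ r →
        search pk ok p r (addAll (faces τ) F) (addAll (faces (rho τ)) G) (τ :: L) = true) ∨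
    ∃ s ∈ G, ∀ τ ∈ cand s, p (rho τ) = true →
      need (addAll (faces τ) G) ≤ r → need (addAll (faces (rho τ)) F) ≤ r →
        search pk ok p r (addAll (faces (rho τ)) F) (addAll (faces τ) G) (rho τ :: L) = true := by
  change select (select (isNil F) (isNil G) false) (ok L)
    (forceNat (pk F G) fun x => forceNat (Nat.mod x 2048) fun s =>
    select (Nat.beq (Nat.mod (Nat.div x 2048) 2) 0)
      (select (anyOf (Nat.beq s) F) (allOf (fun τ => forceNat τ fun τ =>
        select (p τ)
        (forceList (addAll (faces τ) F) fun F' => select (Nat.ble (need F') r)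
          (forceList (addAll (faces (rho τ)) G) fun G' =>
          select (Nat.ble (need G') r) (search pk ok p r F' G' (τ :: L)) true) true) true)
            (cand s)) false)
      (select (anyOf (Nat.beq s) G) (allOf (fun τ' => forceNat τ' fun τ' =>
        forceNat (rho τ') fun τ =>
        select (p τ)
        (forceList (addAll (faces τ') G) fun G' => select (Nat.ble (need G') r)
          (forceList (addAll (faces τ) F) fun F' =>
          select (Nat.ble (need F') r) (search pk ok p r F' G' (τ :: L)) true) true) true)
            (cand s)) false)) = true at h
  simp only [forceNat_eq, forceList_eq] at h
  rw [select_eq] at h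
  by_cases c1 : select (isNil F) (isNil G) false = true
  · rw [if_pos c1] at h
    simp only [select_eq, Bool.ite_eq_true_distrib, isNil_iff, Bool.false_eq_true,
      if_false_right] at c1
    exact Or.inl ⟨c1.1, c1.2, h⟩
  rw [if_neg c1, select_eq] at h
  generalize Nat.mod (pk F G) 2048 = s at h
  right
  split_ifs at h
  · rw [select_eq] at h
    split_ifs at h with c3
    obtain ⟨x, hx, hsx⟩ := (anyOf_iff _ _).1 c3
    obtain rfl := Nat.beq_eq.mp hsx
    refine Or.inl ⟨_, hx, fun τ hτ hp hn hn' => ?_⟩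
    have h1 := (allOf_iff _ _).1 h τ hτ
    simp only [select_eq, Nat.ble_eq] at h1
    rwa [if_pos hp, if_pos hn, if_pos hn'] at h1
  · rw [select_eq] at h
    split_ifs at h with c3
    obtain ⟨x, hx, hsx⟩ := (anyOf_iff _ _).1 c3
    obtain rfl := Nat.beq_eq.mp hsx
    refine Or.inr ⟨_, hx, fun τ hτ hp hn hn' => ?_⟩
    have h1 := (allOf_iff _ _).1 h τ hτ
    simp only [select_eq, Nat.ble_eq] at h1
    rwa [if_pos hp, if_pos hn, if_pos hn'] at h1

theorem fill_sound {ok : List ℕ → Bool} {p : ℕ → Bool} {r : ℕ} (hr : r ≤ 7) {F L : List ℕ}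
    {M : Multiset ℕ} (hF : Red F) (hM : ∀ τ ∈ M, Valid τ ∧ p τ = true) (hc : Multiset.card M ≤ r)
    (h : val F + Fm M = 0) (hs : fill ok p r F L = true) :
    ∃ (L' : List ℕ) (M' : Multiset ℕ), ok L' = true ∧ (L' : Multiset ℕ) + M' = L + M ∧
      Fm M' = 0 ∧ M' ≤ M := by
  induction r generalizing F L M with
  | zero =>
    obtain rfl : M = 0 := Multiset.card_eq_zero.1 (by omega)
    obtain rfl := eq_nil_of_val_eq_zero hF (by simpa using h)
    exact ⟨L, 0, hs, rfl, rfl, le_rfl⟩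
  | succ r ih =>
    cases F with
    | nil => exact ⟨L, M, hs, rfl, by simpa using h, le_rfl⟩
    | cons s F =>
      obtain ⟨τ, hτ, hτs⟩ := exists_mem_cand hF h (fun τ hτ => (hM τ hτ).1) (s := s) (by simp)
      obtain ⟨M, rfl⟩ := Multiset.exists_cons_of_mem hτ
      have hF' : Red (addAll (faces τ) (s :: F)) := hF.addAll _
      have h' := val_addAll_faces h
      have hM' : ∀ τ ∈ M, Valid τ ∧ p τ = true := fun τ hτ => hM τ (Multiset.mem_cons_of_mem hτ)
      rw [Multiset.card_cons] at hc
      have hn := need_le hF' h' (fun τ hτ => (hM' τ hτ).1) (by omega)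
      obtain ⟨L', M', h2, h3, h4, h5⟩ := ih (by omega) hF' hM' (by omega) h'
        (fill_succ_cons hs τ hτs (hM τ hτ).2 (by omega))
      refine ⟨L', M', h2, ?_, h4, h5.trans (Multiset.le_cons_self _ _)⟩
      rw [h3, ← Multiset.cons_coe, Multiset.cons_add, Multiset.add_cons]

theorem search_sound {pk : List ℕ → List ℕ → ℕ} {ok : List ℕ → Bool} {p : ℕ → Bool} {r : ℕ}
    (hr : r ≤ 7) {F G L : List ℕ} {M : Multiset ℕ} (hF : Red F) (hG : Red G)
    (hM : ∀ τ ∈ M, Valid τ ∧ p τ = true) (hc : Multiset.card M ≤ r)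
    (h : val F + Fm M = 0) (h' : val G + Fm (M.map rho) = 0)
    (hs : search pk ok p r F G L = true) :
    ∃ (L' : List ℕ) (M' : Multiset ℕ), ok L' = true ∧ (L' : Multiset ℕ) + M' = L + M ∧
      Fm M' = 0 ∧ Fm (M'.map rho) = 0 ∧ M' ≤ M := by
  induction r generalizing F G L M with
  | zero =>
    obtain rfl : M = 0 := Multiset.card_eq_zero.1 (by omega)
    obtain rfl := eq_nil_of_val_eq_zero hF (by simpa using h)
    obtain rfl := eq_nil_of_val_eq_zero hG (by simpa using h')
    exact ⟨L, 0, hs, rfl, rfl, rfl, le_rfl⟩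
  | succ r ih =>
    have step : ∀ τ ∈ M, (∀ F' G', F' = addAll (faces τ) F → G' = addAll (faces (rho τ)) G →
        need F' ≤ r → need G' ≤ r → search pk ok p r F' G' (τ :: L) = true) →
        ∃ (L' : List ℕ) (M' : Multiset ℕ), ok L' = true ∧ (L' : Multiset ℕ) + M' = L + M ∧
          Fm M' = 0 ∧ Fm (M'.map rho) = 0 ∧ M' ≤ M := by
      intro τ hτ hrec
      obtain ⟨M, rfl⟩ := Multiset.exists_cons_of_mem hτ
      have hM' : ∀ τ ∈ M, Valid τ ∧ p τ = true := fun τ hτ => hM τ (Multiset.mem_cons_of_mem hτ)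
      rw [Multiset.map_cons] at h'
      rw [Multiset.card_cons] at hc
      have h1 := val_addAll_faces h
      have h2 := val_addAll_faces h'
      have n1 := need_le (hF.addAll _) h1 (fun τ hτ => (hM' τ hτ).1) (by omega)
      have n2 := need_le (hG.addAll _) h2 (fun τ hτ => by
        obtain ⟨x, hx, rfl⟩ := Multiset.mem_map.1 hτ
        exact (hM' x hx).1.rho) (by rw [Multiset.card_map]; omega)
      rw [Multiset.card_map] at n2
      obtain ⟨L', M', h3, h4, h5, h6, h7⟩ := ih (by omega) (hF.addAll _) (hG.addAll _) hM'
        (by omega) h1 h2 (hrec _ _ rfl rfl (by omega) (by omega))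
      refine ⟨L', M', h3, ?_, h5, h6, h7.trans (Multiset.le_cons_self _ _)⟩
      rw [h4, ← Multiset.cons_coe, Multiset.cons_add, Multiset.add_cons]
    rcases search_succ hs with ⟨rfl, rfl, h1⟩ | ⟨s, hs, h1⟩ | ⟨s, hs, h1⟩
    · exact ⟨L, M, h1, rfl, by simpa using h, by simpa using h', le_rfl⟩
    · obtain ⟨τ, hτ, hτs⟩ := exists_mem_cand hF h (fun τ hτ => (hM τ hτ).1) hs
      refine step τ hτ fun F' G' e e' n n' => ?_
      subst e e'
      exact h1 τ hτs (hM τ hτ).2 n n'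
    · obtain ⟨τ', hτ', hτs⟩ := exists_mem_cand hG h' (fun τ hτ => by
        obtain ⟨x, hx, rfl⟩ := Multiset.mem_map.1 hτ
        exact (hM x hx).1.rho) hs
      obtain ⟨τ, hτ, rfl⟩ := Multiset.mem_map.1 hτ'
      refine step τ hτ fun F' G' e e' n n' => ?_
      subst e e'
      have h2 := h1 _ hτs
      rw [rho_rho (hM τ hτ).1] at h2
      exact h2 (hM τ hτ).2 n' n

/-! ### Splitting a chain by index -/

theorem eq_zero_of_Fm_eq_zero {M : Multiset ℕ} (hM : ∀ τ ∈ M, Valid τ) (hc : Multiset.card M ≤ 1)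
    (h : Fm M = 0) : M = 0 := by
  by_contra hne
  obtain ⟨τ, rfl⟩ := Multiset.card_eq_one.1
    (le_antisymm hc (Nat.one_le_iff_ne_zero.2 (by simpa using hne)))
  obtain ⟨σ, u, a, b, c, hσ, hu, ha, hb, hc', hab, hbc, rfl⟩ := hM τ (by simp)
  have h1 := congrArg (coeffAt (encFace (1 - σ) u b c)) h
  rw [Fm_eq_sum, coeffAt_sum, map_zero, sub_eq_zero, Nat.cast_inj, Multiset.singleton_bind,
    faces_encTerm u hσ ha hb hc', opp_encFace _ _ _ (by omega)] at h1
  have h2 : 0 < Multiset.count (encFace (1 - σ) u b c) (encFace (1 - σ) u b c ::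
      encFace (1 - σ) u a b :: if a = c then [] else [encFace σ u a c] : List ℕ) :=
    Multiset.count_pos.2 (by simp)
  rw [h1] at h2
  have h3 := Multiset.count_pos.1 h2
  rw [Multiset.mem_coe] at h3
  split_ifs at h3 <;> simp only [List.mem_cons, List.not_mem_nil, or_false, encFace_eq] at h3 <;>
    omega

/-- The part of index `v`. -/
noncomputable def atIndex (v : ℕ) : (ℕ →₀ ℤ) →+ (ℕ →₀ ℤ) :=
  Finsupp.filterAddHom fun n => n / 49 = v

theorem atIndex_sv (v s : ℕ) : atIndex v (sv s) = if s / 98 = v then sv s else 0 := by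
  change Finsupp.filter _ (sv s) = _
  have h : s / 2 / 49 = s / 98 := by omega
  split_ifs with hv
  · exact Finsupp.filter_single_of_pos _ (h.trans hv)
  · exact Finsupp.filter_single_of_neg _ fun h' => hv (h.symm.trans h')

theorem atIndex_fv {τ : ℕ} (h : Valid τ) (v : ℕ) :
    atIndex v (fv τ) = if ind τ = v then fv τ else 0 := by
  have key : ∀ l : List ℕ, (∀ s ∈ l, s / 98 = ind τ) →
      atIndex v (val l) = if ind τ = v then val l else 0 := by
    intro l hl
    induction l with
    | nil => simp
    | cons s l ih =>
      rw [val_cons, map_add, ih fun s hs => hl s (by simp [hs]), atIndex_sv, hl s (by simp)]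
      split_ifs <;> simp
  exact key _ fun s hs => face_index h hs

theorem Fm_filter {M : Multiset ℕ} (hM : ∀ τ ∈ M, Valid τ) (v : ℕ) :
    Fm (M.filter fun τ => ind τ = v) = atIndex v (Fm M) := by
  induction M using Multiset.induction with
  | empty => simp
  | cons τ M ih =>
    rw [Fm_cons, map_add, ← ih fun τ hτ => hM τ (Multiset.mem_cons_of_mem hτ),
      atIndex_fv (hM τ (Multiset.mem_cons_self _ _)), Multiset.filter_cons, Fm_add]
    split_ifs <;> simp [Fm]

theorem exists_small_filter {M : Multiset ℕ} {n : ℕ} (hc : Multiset.card M ≤ 2 * n + 1) {σ τ : ℕ}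
    (hσ : σ ∈ M) (hτ : τ ∈ M) (h : ind σ ≠ ind τ) : ∃ x ∈ M,
      Multiset.card (M.filter fun y => ind y = ind x) ≤ n := by
  have key : Multiset.card (M.filter fun y => ind y = ind σ) +
      Multiset.card (M.filter fun y => ind y = ind τ) ≤ Multiset.card M := by
    have h1 := congrArg Multiset.card (Multiset.filter_add_not (fun y => ind y = ind σ) M)
    have h2 : (M.filter fun y => ind y = ind τ) ≤ M.filter fun y => ¬ind y = ind σ :=
      Multiset.monotone_filter_right M fun y (hy : ind y = ind τ) => by rw [hy]; exact h.symm
    have h3 := Multiset.card_le_card h2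
    rw [Multiset.card_add] at h1
    omega
  by_cases h1 : Multiset.card (M.filter fun y => ind y = ind σ) ≤ n
  · exact ⟨σ, hσ, h1⟩
  · exact ⟨τ, hτ, by omega⟩

/-! ### The reversal of faces -/

noncomputable def Kap : (ℕ →₀ ℤ) →+ (ℕ →₀ ℤ) :=
  Finsupp.mapDomain.addMonoidHom fun n => kap (2 * n) / 2

theorem kap_eq (s : ℕ) : kap s = s % 2 + (2 * (s / 2 % 7) +
    (14 * ((2 * (s / 2 % 7) + 6 * (s / 14 % 7)) % 7) +
      98 * ((s / 98 + (2 * (s / 2 % 7) + 5 * (s / 14 % 7))) % 7))) := by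
  simp only [kap, forceNat_eq]
  rfl

theorem kap_encFace {σ x y : ℕ} (v : ℕ) (hσ : σ < 2) (hx : x < 7) (hy : y < 7) :
    kap (encFace σ v x y) = encFace σ ((v + (2 * y + 5 * x)) % 7) ((2 * y + 6 * x) % 7) y := by
  rw [kap_eq, encFace_eq, encFace_eq]
  have h1 : (σ + (2 * y + (14 * x + 98 * v))) % 2 = σ := by omega
  have h2 : (σ + (2 * y + (14 * x + 98 * v))) / 2 % 7 = y := by omega
  have h3 : (σ + (2 * y + (14 * x + 98 * v))) / 14 % 7 = x := by omega
  have h4 : (σ + (2 * y + (14 * x + 98 * v))) / 98 = v := by omega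
  rw [h1, h2, h3, h4]

theorem mapDomain_sv {φ : ℕ → ℕ} {s t : ℕ} (h : φ (s / 2) = t / 2) (h' : s % 2 = t % 2) :
    Finsupp.mapDomain.addMonoidHom φ (sv s) = sv t := by
  change Finsupp.mapDomain φ (sv s) = _
  rw [sv, Finsupp.mapDomain_single, h, h', sv]

theorem Kap_sv (s : ℕ) : Kap (sv s) = sv (kap s) := by
  refine mapDomain_sv ?_ (by rw [kap_eq]; omega)
  rw [kap_eq, kap_eq]
  have h2 : 2 * (s / 2) / 2 = s / 2 := by omega
  have h3 : 2 * (s / 2) / 14 = s / 14 := by omega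
  have h4 : 2 * (s / 2) / 98 = s / 98 := by omega
  rw [h2, h3, h4]
  omega

theorem val_gFaces (L : List ℕ) : val (gFaces L) = -Kap (Fm (Multiset.map rho L)) := by
  rw [← val_facesG]
  change val ((facesG L).map _) = _
  induction facesG L with
  | nil => simp
  | cons s l ih => rw [List.map_cons, val_cons, ih, sv_opp, val_cons, map_add, Kap_sv, neg_add]

theorem exists_encFace {s : ℕ} (hs : s < 686) :
    ∃ σ v x y, σ < 2 ∧ v < 7 ∧ x < 7 ∧ y < 7 ∧ s = encFace σ v x y := by
  refine ⟨s % 2, s / 98, s / 14 % 7, s / 2 % 7, ?_⟩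
  rw [encFace_eq]
  omega

theorem face_lt {τ s : ℕ} (h : Valid τ) (hs : s ∈ faces τ) : s < 686 := by
  have h1 := face_index h hs
  have h2 := ind_lt h
  omega

theorem opp_lt {s : ℕ} (hs : s < 686) : opp s < 686 := by
  rw [opp_eq]
  split_ifs <;> omega

theorem kap_kap {s : ℕ} (hs : s < 686) : kap (kap s) = s := by
  obtain ⟨σ, v, x, y, hσ, hv, hx, hy, rfl⟩ := exists_encFace hs
  rw [kap_encFace v hσ hx hy, kap_encFace _ hσ (by omega) hy]
  congr 1 <;> omega

theorem kap_opp {s : ℕ} (hs : s < 686) : kap (opp s) = opp (kap s) := by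
  obtain ⟨σ, v, x, y, hσ, hv, hx, hy, rfl⟩ := exists_encFace hs
  rw [opp_encFace _ _ _ hσ, kap_encFace v hσ hx hy, kap_encFace v (by omega) hx hy,
    opp_encFace _ _ _ hσ]

theorem facesG_lt {L : List ℕ} (hL : ∀ τ ∈ L, Valid τ) : ∀ s ∈ facesG L, s < 686 := by
  induction L with
  | nil => simp [facesG]
  | cons τ L ih =>
    have key : ∀ l m : List ℕ, (∀ s ∈ l, s < 686) → (∀ s ∈ m, s < 686) →
        ∀ s ∈ addAll l m, s < 686 := by
      intro l m hl hm
      induction l with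
      | nil => exact hm
      | cons x l ih' =>
        intro s hs
        rcases mem_addFace hs with rfl | hs
        · exact hl s (by simp)
        · exact ih' (fun s hs => hl s (by simp [hs])) s hs
    exact key _ _ (fun s hs => face_lt (hL τ (by simp)).rho hs)
      (ih fun τ hτ => hL τ (by simp [hτ]))

theorem red_gFaces {L : List ℕ} (hL : ∀ τ ∈ L, Valid τ) : Red (gFaces L) := by
  intro x hx hx'
  obtain ⟨s, hs, rfl⟩ := List.mem_map.1 hx
  obtain ⟨s', hs', h⟩ := List.mem_map.1 hx'
  have l := facesG_lt hL s hs
  have l' := facesG_lt hL s' hs'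
  rw [← kap_opp l', ← kap_opp l, ← kap_opp (opp_lt l), opp_opp] at h
  have h1 := congrArg kap h
  rw [kap_kap (opp_lt l'), kap_kap l] at h1
  refine red_facesG L s' hs' ?_
  rwa [h1]

theorem Kap_Kap_Fm {M : Multiset ℕ} (hM : ∀ τ ∈ M, Valid τ) : Kap (Kap (Fm M)) = Fm M := by
  induction M using Multiset.induction with
  | empty => simp
  | cons τ M ih =>
    rw [Fm_cons, map_add, map_add, ih fun τ hτ => hM τ (Multiset.mem_cons_of_mem hτ)]
    congr 1
    have key : ∀ l : List ℕ, (∀ s ∈ l, s < 686) → Kap (Kap (val l)) = val l := by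
      intro l hl
      induction l with
      | nil => simp
      | cons s l ih =>
        rw [val_cons, map_add, map_add, ih fun s hs => hl s (by simp [hs]), Kap_sv, Kap_sv,
          kap_kap (hl s (by simp))]
    exact key _ fun s hs => face_lt (hM τ (Multiset.mem_cons_self _ _)) hs

/-! ### Evaluating the cocycle -/

/-- The value of `ζ` on the translate by `j` of a chain. -/
def zm (j : ℕ) (M : Multiset ℕ) : ZMod 7 := (M.map fun τ => (zetaNat j τ : ZMod 7)).sum

@[simp] theorem zm_add (j : ℕ) (M N : Multiset ℕ) : zm j (M + N) = zm j M + zm j N := by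
  simp [zm]

/-- All translates of the chain and of its reverse are killed by `ζ`. -/
def Killed (M : Multiset ℕ) : Prop := ∀ j, zm j M = 0 ∧ zm j (M.map rho) = 0

theorem zetaNat_encTerm {σ a b c : ℕ} (j u : ℕ) (hσ : σ < 2) (ha : a < 7) (hb : b < 7)
    (hc : c < 7) : (zetaNat j (encTerm σ u a b c) : ZMod 7) = (if σ = 0 then 1 else 6) *
      ((a - b) * (2 * (3 * (c + j) ^ 5 * (b - c) ^ 2 + 5 * (c + j) ^ 3 * (b - c) ^ 4 +
        (c + j) * (b - c) ^ 6))) := by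
  rw [zetaNat, withTerm_encTerm _ _ hσ ha hb hc]
  have h7 : (7 : ZMod 7) = 0 := rfl
  push_cast [Nat.cast_sub (show b ≤ a + 7 by omega), Nat.cast_sub (show c ≤ b + 7 by omega)]
  rw [h7]
  simp only [add_zero]

theorem zetaNat_mod (j τ : ℕ) : (zetaNat (j % 7) τ : ZMod 7) = zetaNat j τ := by
  rw [zetaNat, zetaNat, withTerm_eq, withTerm_eq]
  push_cast
  simp only [ZMod.natCast_mod]

theorem killed_of_zetaTest {L : List ℕ} (h : zetaTest L = true) : Killed L := by
  have key : ∀ (j : ℕ) (l : List ℕ), (zetaSum j l : ZMod 7) = zm j l := by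
    intro j l
    induction l with
    | nil => rfl
    | cons τ l ih =>
      change ((zetaNat j τ + zetaSum j l : ℕ) : ZMod 7) = _
      rw [Nat.cast_add, ih]
      simp [zm]
  intro j
  have hj : j % 7 ∈ [0, 1, 2, 3, 4, 5, 6] := by
    simp only [List.mem_cons, List.not_mem_nil, or_false]
    omega
  have h1 := (allOf_iff _ _).1 h _ hj
  simp only [select_eq, Nat.beq_eq, Bool.ite_eq_true_distrib] at h1
  have h2 : ∀ M, zm (j % 7) M = zm j M := by
    intro M
    simp only [zm, zetaNat_mod]
  split_ifs at h1 with h3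
  rw [Multiset.map_coe, ← h2, ← key, ← h2, ← key]
  exact ⟨(ZMod.natCast_eq_zero_iff _ _).2 (Nat.dvd_of_mod_eq_zero h3),
    (ZMod.natCast_eq_zero_iff _ _).2 (Nat.dvd_of_mod_eq_zero h1)⟩

/-! ### Symmetries -/

/-- The term `(u; a, b, c)` satisfies `a = c`. -/
def Bigon (τ : ℕ) : Prop := τ / 98 % 7 = τ / 2 % 7

theorem bigon_encTerm {σ a b c : ℕ} (u : ℕ) (hσ : σ < 2) (ha : a < 7) (hb : b < 7) (hc : c < 7) :
    Bigon (encTerm σ u a b c) ↔ a = c := by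
  rw [Bigon, encTerm_eq]
  have h1 : (σ + (2 * c + (14 * b + (98 * a + 686 * u)))) / 98 % 7 = a := by omega
  have h2 : (σ + (2 * c + (14 * b + (98 * a + 686 * u)))) / 2 % 7 = c := by omega
  rw [h1, h2]

/-- `T` is a symmetry of the set of signed terms, and `D` the map it induces on faces. -/
structure Symmetry (T : ℕ → ℕ) (D : (ℕ →₀ ℤ) →+ (ℕ →₀ ℤ)) : Prop where
  valid : ∀ {τ}, Valid τ → Valid (T τ)
  rho : ∀ {τ}, Valid τ → T (rho τ) = rho (T τ)
  opp : ∀ {τ}, Valid τ → T (opp τ) = opp (T τ)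
  ind : ∀ {τ τ'}, Valid τ → Valid τ' → (ind (T τ) = ind (T τ') ↔ ind τ = ind τ')
  inj : ∀ {τ τ'}, Valid τ → Valid τ' → T τ = T τ' → τ = τ'
  bigon : ∀ {τ}, Valid τ → (Bigon (T τ) ↔ Bigon τ)
  fv : ∀ {τ}, Valid τ → fv (T τ) = D (fv τ)
  kap : ∀ {τ}, Valid τ → Kap (D (QHom.fv τ)) = D (Kap (QHom.fv τ))
  zeta : ∀ j, ∃ (j' : ℕ) (c : ZMod 7), ∀ τ, Valid τ →
    (zetaNat j τ : ZMod 7) = c * zetaNat j' (T τ)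

theorem Symmetry.comp {T T' : ℕ → ℕ} {D D' : (ℕ →₀ ℤ) →+ (ℕ →₀ ℤ)} (h' : Symmetry T' D')
    (h : Symmetry T D) : Symmetry (T' ∘ T) (D'.comp D) where
  valid hτ := h'.valid (h.valid hτ)
  rho hτ := by
    rw [Function.comp_apply, h.rho hτ, h'.rho (h.valid hτ), Function.comp_apply]
  opp hτ := by
    rw [Function.comp_apply, h.opp hτ, h'.opp (h.valid hτ), Function.comp_apply]
  ind hτ hτ' := (h'.ind (h.valid hτ) (h.valid hτ')).trans (h.ind hτ hτ')
  inj hτ hτ' e := h.inj hτ hτ' (h'.inj (h.valid hτ) (h.valid hτ') e)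
  bigon hτ := (h'.bigon (h.valid hτ)).trans (h.bigon hτ)
  fv hτ := by
    rw [Function.comp_apply, h'.fv (h.valid hτ), h.fv hτ, AddMonoidHom.comp_apply]
  kap hτ := by
    rw [AddMonoidHom.comp_apply, ← h.fv hτ, h'.kap (h.valid hτ), h.fv hτ, h.kap hτ,
      AddMonoidHom.comp_apply]
  zeta j := by
    obtain ⟨j', c, h1⟩ := h.zeta j
    obtain ⟨j'', c', h2⟩ := h'.zeta j'
    refine ⟨j'', c * c', fun τ hτ => ?_⟩
    rw [h1 τ hτ, h2 _ (h.valid hτ), mul_assoc, Function.comp_apply]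

theorem symmetry_opp : Symmetry opp (-AddMonoidHom.id _) where
  valid := Valid.opp
  rho hτ := (rho_opp hτ).symm
  opp _ := rfl
  ind hτ hτ' := by rw [ind_opp hτ, ind_opp hτ']
  inj {τ τ'} _ _ e := by rw [← opp_opp τ, e, opp_opp]
  bigon hτ := by
    obtain ⟨σ, u, a, b, c, hσ, hu, ha, hb, hc, hab, hbc, rfl⟩ := hτ
    rw [opp_encTerm _ _ _ _ hσ, bigon_encTerm u (by omega) ha hb hc, bigon_encTerm u hσ ha hb hc]
  fv hτ := fv_opp hτ
  kap _ := by
    simp only [AddMonoidHom.neg_apply, AddMonoidHom.id_apply, map_neg]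
  zeta j := by
    refine ⟨j, -1, fun _ hτ => ?_⟩
    obtain ⟨σ, u, a, b, c, hσ, hu, ha, hb, hc, hab, hbc, rfl⟩ := hτ
    rw [opp_encTerm _ _ _ _ hσ, zetaNat_encTerm j u hσ ha hb hc,
      zetaNat_encTerm j u (by omega) ha hb hc]
    have h6 : (6 : ZMod 7) = -1 := rfl
    obtain rfl | rfl : σ = 0 ∨ σ = 1 := by omega
    · simp [h6]
    · simp [h6]

theorem eq_of_cast_eq {m n : ℕ} (hm : m < 7) (hn : n < 7) (h : (m : ZMod 7) = n) : m = n := by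
  have h1 := (ZMod.natCast_eq_natCast_iff' _ _ _).1 h
  rwa [Nat.mod_eq_of_lt hm, Nat.mod_eq_of_lt hn] at h1

def aff (d e x : ℕ) : ℕ := (d * x + e) % 7

theorem aff_lt (d e x : ℕ) : aff d e x < 7 := Nat.mod_lt _ (by norm_num)

theorem cast_aff (d e x : ℕ) : (aff d e x : ZMod 7) = d * x + e := by
  rw [aff, ZMod.natCast_mod]
  push_cast
  rfl

theorem aff_inj {d e x y : ℕ} (hd : (d : ZMod 7) ≠ 0) (hx : x < 7) (hy : y < 7) :
    aff d e x = aff d e y ↔ x = y := by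
  have : Fact (Nat.Prime 7) := ⟨by norm_num⟩
  refine ⟨fun h => eq_of_cast_eq hx hy ?_, fun h => by rw [h]⟩
  have h1 := congrArg (Nat.cast : ℕ → ZMod 7) h
  rw [cast_aff, cast_aff] at h1
  exact mul_left_cancel₀ hd (add_right_cancel h1)

/-- The affine map `x ↦ d x + e` on signed terms. -/
def affTerm (d e τ : ℕ) : ℕ :=
  withTerm τ fun σ u a b c => encTerm σ (aff d e u) (aff d e a) (aff d e b) (aff d e c)

theorem affTerm_encTerm {σ a b c : ℕ} (d e u : ℕ) (hσ : σ < 2) (ha : a < 7) (hb : b < 7)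
    (hc : c < 7) : affTerm d e (encTerm σ u a b c) =
      encTerm σ (aff d e u) (aff d e a) (aff d e b) (aff d e c) := by
  rw [affTerm, withTerm_encTerm _ u hσ ha hb hc]

noncomputable def affFace (d e : ℕ) : (ℕ →₀ ℤ) →+ (ℕ →₀ ℤ) :=
  Finsupp.mapDomain.addMonoidHom fun n =>
    aff d e (n % 7) + 7 * aff d e (n / 7 % 7) + 49 * aff d e (n / 49)

theorem affFace_sv {σ v x y : ℕ} (d e : ℕ) (hσ : σ < 2) (hx : x < 7) (hy : y < 7) :
    affFace d e (sv (encFace σ v x y)) =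
      sv (encFace σ (aff d e v) (aff d e x) (aff d e y)) := by
  refine mapDomain_sv ?_ (by rw [encFace_eq, encFace_eq]; omega)
  have h1 : encFace σ v x y / 2 % 7 = y := by rw [encFace_eq]; omega
  have h2 : encFace σ v x y / 2 / 7 % 7 = x := by rw [encFace_eq]; omega
  have h3 : encFace σ v x y / 2 / 49 = v := by rw [encFace_eq]; omega
  rw [h1, h2, h3, encFace_eq]
  omega

theorem symmetry_affTerm {d : ℕ} (e : ℕ) (hd : (d : ZMod 7) ≠ 0) :
    Symmetry (affTerm d e) (affFace d e) where
  valid hτ := by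
    obtain ⟨σ, u, a, b, c, hσ, hu, ha, hb, hc, hab, hbc, rfl⟩ := hτ
    rw [affTerm_encTerm d e u hσ ha hb hc]
    exact valid_encTerm hσ (aff_lt _ _ _) (aff_lt _ _ _) (aff_lt _ _ _) (aff_lt _ _ _)
      (by rwa [Ne, aff_inj hd ha hb]) (by rwa [Ne, aff_inj hd hb hc])
  rho hτ := by
    obtain ⟨σ, u, a, b, c, hσ, hu, ha, hb, hc, hab, hbc, rfl⟩ := hτ
    have lt := aff_lt d e
    have h7 : (7 : ZMod 7) = 0 := rfl
    rw [affTerm_encTerm d e u hσ ha hb hc, rho_encTerm _ hσ (lt _) (lt _) (lt _),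
      rho_encTerm u hσ ha hb hc, affTerm_encTerm d e _ hσ (by omega) (by omega) hc]
    congr 1 <;> refine eq_of_cast_eq (lt _) (by omega) ?_ <;> rw [cast_aff] <;>
      push_cast [ZMod.natCast_mod, cast_aff]
    · linear_combination -2 * (e : ZMod 7) * h7
    · linear_combination -(e : ZMod 7) * h7
    · linear_combination -(e : ZMod 7) * h7
  opp hτ := by
    obtain ⟨σ, u, a, b, c, hσ, hu, ha, hb, hc, hab, hbc, rfl⟩ := hτ
    rw [opp_encTerm _ _ _ _ hσ, affTerm_encTerm d e u (by omega) ha hb hc,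
      affTerm_encTerm d e u hσ ha hb hc, opp_encTerm _ _ _ _ hσ]
  ind hτ hτ' := by
    obtain ⟨σ, u, a, b, c, hσ, hu, ha, hb, hc, hab, hbc, rfl⟩ := hτ
    obtain ⟨σ', u', a', b', c', hσ', hu', ha', hb', hc', hab', hbc', rfl⟩ := hτ'
    have lt := aff_lt d e
    rw [affTerm_encTerm d e u hσ ha hb hc, affTerm_encTerm d e u' hσ' ha' hb' hc',
      ind_encTerm _ hσ (lt _) (lt _) (lt _), ind_encTerm _ hσ' (lt _) (lt _) (lt _),
      ind_encTerm _ hσ ha hb hc, ind_encTerm _ hσ' ha' hb' hc', aff_inj hd hu hu']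
  inj hτ hτ' h := by
    obtain ⟨σ, u, a, b, c, hσ, hu, ha, hb, hc, hab, hbc, rfl⟩ := hτ
    obtain ⟨σ', u', a', b', c', hσ', hu', ha', hb', hc', hab', hbc', rfl⟩ := hτ'
    rw [affTerm_encTerm d e u hσ ha hb hc, affTerm_encTerm d e u' hσ' ha' hb' hc',
      encTerm_eq, encTerm_eq] at h
    have l := aff_lt d e u
    have l' := aff_lt d e u'
    have la := aff_lt d e a
    have la' := aff_lt d e a'
    have lb := aff_lt d e b
    have lb' := aff_lt d e b'
    have lc := aff_lt d e c
    have lc' := aff_lt d e c'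
    have eu : aff d e u = aff d e u' := by omega
    have ea : aff d e a = aff d e a' := by omega
    have eb : aff d e b = aff d e b' := by omega
    have ec : aff d e c = aff d e c' := by omega
    rw [(aff_inj hd hu hu').1 eu, (aff_inj hd ha ha').1 ea, (aff_inj hd hb hb').1 eb,
      (aff_inj hd hc hc').1 ec, show σ = σ' by omega]
  bigon hτ := by
    obtain ⟨σ, u, a, b, c, hσ, hu, ha, hb, hc, hab, hbc, rfl⟩ := hτ
    have lt := aff_lt d e
    rw [affTerm_encTerm d e u hσ ha hb hc, bigon_encTerm _ hσ (lt _) (lt _) (lt _),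
      bigon_encTerm _ hσ ha hb hc, aff_inj hd ha hc]
  fv hτ := by
    obtain ⟨σ, u, a, b, c, hσ, hu, ha, hb, hc, hab, hbc, rfl⟩ := hτ
    have lt := aff_lt d e
    rw [affTerm_encTerm d e u hσ ha hb hc, QHom.fv, QHom.fv,
      faces_encTerm _ hσ (lt _) (lt _) (lt _), faces_encTerm u hσ ha hb hc]
    simp only [aff_inj hd ha hc]
    have hσ' : 1 - σ < 2 := by omega
    split_ifs <;> simp only [val_cons, val_nil, map_add, map_zero, affFace_sv d e hσ' hb hc,
      affFace_sv d e hσ' ha hb, affFace_sv d e hσ ha hc]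
  kap hτ := by
    have key : ∀ l : List ℕ, (∀ s ∈ l, s < 686) →
        Kap (affFace d e (val l)) = affFace d e (Kap (val l)) := by
      intro l hl
      induction l with
      | nil => simp
      | cons s l ih =>
        rw [val_cons, map_add, map_add, map_add, map_add, ih fun s hs => hl s (by simp [hs])]
        congr 1
        obtain ⟨σ, v, x, y, hσ, hv, hx, hy, rfl⟩ := exists_encFace (hl s (by simp))
        have lt := aff_lt d e
        have h7 : (7 : ZMod 7) = 0 := rfl
        rw [Kap_sv, affFace_sv d e hσ hx hy, Kap_sv, kap_encFace v hσ hx hy,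
          kap_encFace _ hσ (lt _) (lt _), affFace_sv d e hσ (by omega) hy]
        congr 2 <;> refine eq_of_cast_eq (by omega) (lt _) ?_ <;> rw [cast_aff] <;>
          push_cast [ZMod.natCast_mod, cast_aff]
        · linear_combination (e : ZMod 7) * h7
        · linear_combination (e : ZMod 7) * h7
    exact key _ fun s hs => face_lt hτ hs
  zeta j := by
    have : Fact (Nat.Prime 7) := ⟨by norm_num⟩
    refine ⟨d * j + 6 * e, ((d : ZMod 7) ^ 8)⁻¹, fun τ hτ => ?_⟩
    obtain ⟨σ, u, a, b, c, hσ, hu, ha, hb, hc, hab, hbc, rfl⟩ := hτ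
    have lt := aff_lt d e
    rw [affTerm_encTerm d e u hσ ha hb hc, zetaNat_encTerm _ _ hσ (lt _) (lt _) (lt _),
      zetaNat_encTerm _ _ hσ ha hb hc, eq_inv_mul_iff_mul_eq₀ (pow_ne_zero _ hd)]
    have h1 : (d * c + e + (d * j + 6 * e) : ZMod 7) = d * (c + j) := by
      have h7 : (7 : ZMod 7) = 0 := rfl
      linear_combination (e : ZMod 7) * h7
    push_cast [cast_aff]
    rw [h1]
    ring

theorem exists_aff : ∀ a < 7, ∀ b < 7, a ≠ b → ∃ d < 7, ∃ e < 7, d ≠ 0 ∧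
    (d * a + e) % 7 = 0 ∧ (d * b + e) % 7 = 1 := by
  decide

/-- Every signed term can be normalised by a symmetry. -/
theorem exists_symmetry {τ : ℕ} (hτ : Valid τ) : ∃ T D, Symmetry T D ∧
    ∃ u c, u < 7 ∧ c < 7 ∧ c ≠ 1 ∧ T τ = encTerm 0 u 0 1 c := by
  obtain ⟨σ, u, a, b, c, hσ, hu, ha, hb, hc, hab, hbc, rfl⟩ := hτ
  obtain ⟨d, hd, e, he, hd0, h0, h1⟩ := exists_aff a ha b hb hab
  have hd' : (d : ZMod 7) ≠ 0 := fun h => hd0 (eq_of_cast_eq hd (by norm_num) (by simpa using h))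
  have hc' : aff d e c ≠ 1 := fun h => hbc ((aff_inj hd' hb hc).1 (h1.trans h.symm))
  have h2 := affTerm_encTerm d e u hσ ha hb hc
  rw [show aff d e a = 0 from h0, show aff d e b = 1 from h1] at h2
  have hS := symmetry_affTerm e hd'
  obtain rfl | rfl : σ = 0 ∨ σ = 1 := by omega
  · exact ⟨_, _, hS, _, _, aff_lt _ _ _, aff_lt _ _ _, hc', h2⟩
  · refine ⟨_, _, symmetry_opp.comp hS, aff d e u, aff d e c, aff_lt _ _ _,
      aff_lt _ _ _, hc', ?_⟩
    rw [Function.comp_apply, h2, opp_encTerm _ _ _ _ (by norm_num)]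

namespace Symmetry

variable {T : ℕ → ℕ} {D : (ℕ →₀ ℤ) →+ (ℕ →₀ ℤ)}

theorem Fm_map (h : Symmetry T D) {M : Multiset ℕ} (hM : ∀ τ ∈ M, Valid τ) :
    Fm (M.map T) = D (Fm M) := by
  rw [Fm, Fm, Multiset.map_map, map_multiset_sum, Multiset.map_map]
  exact congrArg _ (Multiset.map_congr rfl fun τ hτ => h.fv (hM τ hτ))

theorem Kap_Fm (h : Symmetry T D) {M : Multiset ℕ} (hM : ∀ τ ∈ M, Valid τ) :
    Kap (D (Fm M)) = D (Kap (Fm M)) := by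
  rw [Fm]
  simp only [map_multiset_sum, Multiset.map_map]
  exact congrArg _ (Multiset.map_congr rfl fun τ hτ => h.kap (hM τ hτ))

theorem map_rho (h : Symmetry T D) {M : Multiset ℕ} (hM : ∀ τ ∈ M, Valid τ) :
    (M.map T).map QHom.rho = (M.map QHom.rho).map T := by
  rw [Multiset.map_map, Multiset.map_map]
  exact Multiset.map_congr rfl fun τ hτ => (h.rho (hM τ hτ)).symm

theorem killed (h : Symmetry T D) {M : Multiset ℕ} (hM : ∀ τ ∈ M, Valid τ)
    (hk : Killed (M.map T)) : Killed M := by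
  intro j
  obtain ⟨j', c, h1⟩ := h.zeta j
  have key : ∀ N : Multiset ℕ, (∀ τ ∈ N, Valid τ) → zm j N = c * zm j' (N.map T) := by
    intro N hN
    rw [zm, zm, Multiset.map_map, ← Multiset.sum_map_mul_left]
    exact congrArg _ (Multiset.map_congr rfl fun τ hτ => h1 τ (hN τ hτ))
  have hM' : ∀ τ ∈ M.map QHom.rho, Valid τ := fun τ hτ => by
    obtain ⟨x, hx, rfl⟩ := Multiset.mem_map.1 hτ
    exact (hM x hx).rho
  rw [key M hM, key _ hM', ← h.map_rho hM, (hk j').1, (hk j').2]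
  simp

end Symmetry

/-! ### Closed chains of one degree -/

/-- No two terms of the chain cancel. -/
def Reduced (M : Multiset ℕ) : Prop := ∀ τ ∈ M, opp τ ∉ M

theorem Reduced.mono {M N : Multiset ℕ} (h : Reduced M) (hN : N ≤ M) : Reduced N :=
  fun τ hτ h' => h τ (Multiset.mem_of_le hN hτ) (Multiset.mem_of_le hN h')

theorem valid_map_rho {M : Multiset ℕ} (hM : ∀ τ ∈ M, Valid τ) : ∀ τ ∈ M.map rho, Valid τ := by
  intro τ hτ
  obtain ⟨x, hx, rfl⟩ := Multiset.mem_map.1 hτ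
  exact (hM x hx).rho

theorem map_rho_rho {M : Multiset ℕ} (hM : ∀ τ ∈ M, Valid τ) : (M.map rho).map rho = M := by
  rw [Multiset.map_map]
  exact (Multiset.map_congr rfl fun τ hτ => rho_rho (hM τ hτ)).trans (Multiset.map_id _)

theorem Reduced.map_rho {M : Multiset ℕ} (h : Reduced M) (hM : ∀ τ ∈ M, Valid τ) :
    Reduced (M.map rho) := by
  intro τ hτ hτ'
  obtain ⟨x, hx, rfl⟩ := Multiset.mem_map.1 hτ
  obtain ⟨y, hy, h1⟩ := Multiset.mem_map.1 hτ'
  rw [← rho_opp (hM x hx)] at h1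
  have h2 := congrArg rho h1
  rw [rho_rho (hM y hy), rho_rho (hM x hx).opp] at h2
  exact h x hx (h2 ▸ hy)

namespace Symmetry

variable {T : ℕ → ℕ} {D : (ℕ →₀ ℤ) →+ (ℕ →₀ ℤ)}

theorem valid_map (h : Symmetry T D) {M : Multiset ℕ} (hM : ∀ τ ∈ M, Valid τ) :
    ∀ τ ∈ M.map T, Valid τ := by
  intro τ hτ
  obtain ⟨x, hx, rfl⟩ := Multiset.mem_map.1 hτ
  exact h.valid (hM x hx)

theorem reduced_map (h : Symmetry T D) {M : Multiset ℕ} (hM : ∀ τ ∈ M, Valid τ)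
    (hr : Reduced M) : Reduced (M.map T) := by
  intro τ hτ hτ'
  obtain ⟨x, hx, rfl⟩ := Multiset.mem_map.1 hτ
  obtain ⟨y, hy, h1⟩ := Multiset.mem_map.1 hτ'
  rw [← h.opp (hM x hx)] at h1
  exact hr x hx (h.inj (hM y hy) (hM x hx).opp h1 ▸ hy)

end Symmetry

theorem mem_seven {u : ℕ} (hu : u < 7) : u ∈ [0, 1, 2, 3, 4, 5, 6] := by
  simp only [List.mem_cons, List.not_mem_nil, or_false]
  omega

theorem val_facesF_singleton (τ : ℕ) (M : Multiset ℕ) :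
    val (facesF [τ]) + Fm M = Fm (τ ::ₘ M) := by
  rw [val_facesF, ← Fm_add]
  rfl

theorem val_facesG_singleton (τ : ℕ) (M : Multiset ℕ) :
    val (facesG [τ]) + Fm (M.map rho) = Fm ((τ ::ₘ M).map rho) := by
  rw [val_facesG, ← Fm_add, ← Multiset.map_add]
  rfl

theorem Reduced.excludes {τ x : ℕ} {M : Multiset ℕ} (h : Reduced (τ ::ₘ M)) (hx : x ∈ M) :
    excludes τ x = true := by
  simp only [QHom.excludes, Bool.not_eq_true', ← Bool.not_eq_true, Nat.beq_eq]
  rintro rfl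
  exact h τ (Multiset.mem_cons_self _ _) (Multiset.mem_cons_of_mem hx)

theorem exists_bigon {M : Multiset ℕ} (hM : ∀ τ ∈ M, Valid τ) (hr : Reduced M)
    (hc : Multiset.card M ≤ 3) (h0 : M ≠ 0) (h : Fm M = 0) : ∃ τ ∈ M, Bigon τ := by
  by_contra! hb
  obtain ⟨τ, hτ⟩ := Multiset.exists_mem_of_ne_zero h0
  obtain ⟨T, D, hT, u, c, hu, hc7, hc1, e⟩ := exists_symmetry (hM τ hτ)
  obtain ⟨M, rfl⟩ := Multiset.exists_cons_of_mem hτ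
  have hb' : ∀ x ∈ (τ ::ₘ M).map T, ¬ Bigon x := by
    intro x hx
    obtain ⟨y, hy, rfl⟩ := Multiset.mem_map.1 hx
    exact fun h' => hb y hy ((hT.bigon (hM y hy)).1 h')
  have h' : Fm ((τ ::ₘ M).map T) = 0 := by rw [hT.Fm_map hM, h, map_zero]
  have hM' := hT.valid_map hM
  have hr' := hT.reduced_map hM hr
  rw [Multiset.map_cons, e] at hb' h' hM' hr'
  have hc0 : c ≠ 0 := by
    have := hb' _ (Multiset.mem_cons_self _ _)
    rw [bigon_encTerm u (by norm_num) (by norm_num) (by norm_num) hc7] at this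
    exact fun h => this h.symm
  have hs := (allOf_iff _ _).1 ((allOf_iff _ _).1 testNoBigon_true u (mem_seven hu)) c (by
    simp only [List.mem_cons, List.not_mem_nil, or_false]
    omega)
  simp only [testNoBigon, forceNat_eq, forceList_eq] at hs
  rw [Multiset.card_cons] at hc
  obtain ⟨L', M', h1, -⟩ := fill_sound (M := M.map T) (by norm_num) (red_facesF _) (fun x hx => by
    have hx' := Multiset.mem_cons_of_mem (b := encTerm 0 u 0 1 c) hx
    refine ⟨hM' x hx', ?_⟩
    have := hb' x hx'
    rw [Bigon] at this
    rw [withTerm_eq, select_eq, if_neg (by rwa [Nat.beq_eq]), hr'.excludes hx])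
    (by rw [Multiset.card_map]; omega) ((val_facesF_singleton _ _).trans h') hs
  exact Bool.false_ne_true h1

theorem exists_start {test : ℕ → List ℕ → Bool}
    (htest : allOf (fun u => testStart (test u) u) [0, 1, 2, 3, 4, 5, 6] = true)
    (h2 : ∀ u L, test u L = true → 2 ≤ L.length) {M : Multiset ℕ} (hM : ∀ τ ∈ M, Valid τ)
    (hr : Reduced M) (hc : Multiset.card M ≤ 3) (h0 : M ≠ 0) (h : Fm M = 0) :
    ∃ T D, Symmetry T D ∧ ∃ u L, test u L = true ∧ (L : Multiset ℕ) = M.map T ∧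
      ∃ τ ∈ M, ind (T τ) = u := by
  obtain ⟨τ, hτ, hb⟩ := exists_bigon hM hr hc h0 h
  obtain ⟨T, D, hT, u, c, hu, hc7, hc1, e⟩ := exists_symmetry (hM τ hτ)
  refine ⟨T, D, hT, u, ?_⟩
  rw [← hT.bigon (hM τ hτ), e, bigon_encTerm u (by norm_num) (by norm_num) (by norm_num) hc7] at hb
  subst hb
  have hu' : ind (T τ) = u := by
    rw [e, ind_encTerm u (by norm_num) (by norm_num) (by norm_num) hc7]
  obtain ⟨M, rfl⟩ := Multiset.exists_cons_of_mem hτ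
  have h' : Fm ((τ ::ₘ M).map T) = 0 := by rw [hT.Fm_map hM, h, map_zero]
  have hM' := hT.valid_map hM
  have hr' := hT.reduced_map hM hr
  rw [Multiset.map_cons, e] at h' hM' hr'
  rw [Multiset.map_cons, e]
  have hs := (allOf_iff _ _).1 htest u (mem_seven hu)
  simp only [testStart, forceNat_eq, forceList_eq] at hs
  rw [Multiset.card_cons] at hc
  obtain ⟨L', M', h1, h3, h4, h5⟩ := fill_sound (M := M.map T) (by norm_num) (red_facesF _)
    (fun x hx => ⟨hM' x (Multiset.mem_cons_of_mem hx), hr'.excludes hx⟩)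
    (by rw [Multiset.card_map]; omega) ((val_facesF_singleton _ _).trans h') hs
  have h6 := congrArg Multiset.card h3
  simp only [Multiset.card_add, Multiset.coe_card, List.length_singleton,
    Multiset.card_map] at h6
  have h7 := h2 _ _ h1
  obtain rfl := eq_zero_of_Fm_eq_zero
    (fun x hx => hM' x (Multiset.mem_cons_of_mem (Multiset.mem_of_le h5 hx))) (by omega) h4
  rw [add_zero] at h3
  exact ⟨L', h1, h3, τ, hτ, hu'⟩

theorem length_of_testSingle {u : ℕ} {L : List ℕ} (h : testSingle u L = true) : 2 ≤ L.length := by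
  rw [testSingle, select_eq] at h
  split_ifs at h with h1
  exact Nat.le_of_ble_eq_true h1

theorem ind_eq_of_closed {M : Multiset ℕ} (hM : ∀ τ ∈ M, Valid τ) (hr : Reduced M)
    (hc : Multiset.card M ≤ 7) (h : Fm M = 0) (h' : Fm (M.map rho) = 0) {σ τ : ℕ} (hσ : σ ∈ M)
    (hτ : τ ∈ M) : ind σ = ind τ := by
  by_contra hne
  obtain ⟨x, hx, hx3⟩ := exists_small_filter (n := 3) hc hσ hτ hne
  set N := M.filter fun y => ind y = ind x with hN
  set R := M.filter fun y => ¬ind y = ind x with hR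
  have hNR : N + R = M := Multiset.filter_add_not _ _
  have hNM : N ≤ M := Multiset.filter_le _ _
  have hRM : R ≤ M := Multiset.filter_le _ _
  have hNv : ∀ τ ∈ N, Valid τ := fun τ hτ => hM τ (Multiset.mem_of_le hNM hτ)
  have hRv : ∀ τ ∈ R, Valid τ := fun τ hτ => hM τ (Multiset.mem_of_le hRM hτ)
  have hFN : Fm N = 0 := by rw [hN, Fm_filter hM, h, map_zero]
  have hFR : Fm R = 0 := by
    rw [← hNR, Fm_add, hFN, zero_add] at h
    exact h
  have hN0 : N ≠ 0 := by
    have : x ∈ N := Multiset.mem_filter.2 ⟨hx, rfl⟩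
    rintro e
    simp [e] at this
  obtain ⟨T, D, hT, u, L, h1, h2, y, hy, hyu⟩ := exists_start testStart_testSingle
    (fun _ _ => length_of_testSingle) hNv (hr.mono hNM) hx3 hN0 hFN
  have hcard := congrArg Multiset.card h2
  have hcard' := congrArg Multiset.card hNR
  rw [Multiset.coe_card, Multiset.card_map] at hcard
  rw [Multiset.card_add] at hcard'
  rw [testSingle, select_eq, forceList_eq] at h1
  split_ifs at h1
  obtain ⟨L', M', h3, -⟩ := search_sound (M := R.map T) (by omega) red_nil (red_facesG L)
    (fun z hz => by
      refine ⟨hT.valid_map hRv z hz, ?_⟩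
      obtain ⟨w, hw, rfl⟩ := Multiset.mem_map.1 hz
      simp only [Bool.not_eq_true', ← Bool.not_eq_true, Nat.beq_eq]
      rw [← hyu, hT.ind (hRv w hw) (hNv y hy), (Multiset.mem_filter.1 hy).2]
      exact (Multiset.mem_filter.1 hw).2)
    (by rw [Multiset.card_map]; omega)
    (by rw [val_nil, hT.Fm_map hRv, hFR, map_zero, add_zero])
    (by
      rw [val_facesG, h2, ← Fm_add, ← Multiset.map_add, ← Multiset.map_add, hNR, hT.map_rho hM,
        hT.Fm_map (valid_map_rho hM), h', map_zero]) h1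
  exact Bool.false_ne_true h3

/-- A closed chain of one degree, closed under `f` and `g`, of length at most seven is zero. -/
theorem eq_zero_of_closed {M : Multiset ℕ} (hM : ∀ τ ∈ M, Valid τ) (hr : Reduced M)
    (hc : Multiset.card M ≤ 7) (h : Fm M = 0) (h' : Fm (M.map rho) = 0) : M = 0 := by
  by_contra h0
  obtain ⟨τ, hτ⟩ := Multiset.exists_mem_of_ne_zero h0
  have i1 : ∀ y ∈ M, ind y = ind τ := fun y hy => ind_eq_of_closed hM hr hc h h' hy hτ
  have i2 : ∀ y ∈ M, ind (rho y) = ind (rho τ) := fun y hy =>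
    ind_eq_of_closed (valid_map_rho hM) (hr.map_rho hM) (by rwa [Multiset.card_map]) h'
      (by rwa [map_rho_rho hM]) (Multiset.mem_map_of_mem _ hy) (Multiset.mem_map_of_mem _ hτ)
  obtain ⟨T, D, hT, u, c, hu, hc7, hc1, e⟩ := exists_symmetry (hM τ hτ)
  have hu' : ind (T τ) = u := by
    rw [e, ind_encTerm u (by norm_num) (by norm_num) (by norm_num) hc7]
  obtain ⟨M, rfl⟩ := Multiset.exists_cons_of_mem hτ
  have hF : Fm ((τ ::ₘ M).map T) = 0 := by rw [hT.Fm_map hM, h, map_zero]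
  have hG : Fm (((τ ::ₘ M).map T).map rho) = 0 := by
    rw [hT.map_rho hM, hT.Fm_map (valid_map_rho hM), h', map_zero]
  have hM' := hT.valid_map hM
  have hr' := hT.reduced_map hM hr
  rw [Multiset.map_cons, e] at hF hG hM' hr'
  have hs := (allOf_iff _ _).1 ((allOf_iff _ _).1 testCell_true u (mem_seven hu)) c (by
    simp only [List.mem_cons, List.not_mem_nil, or_false]
    omega)
  simp only [testCell, forceNat_eq, forceList_eq] at hs
  rw [Multiset.card_cons] at hc
  obtain ⟨L', M', h1, -⟩ := search_sound (M := M.map T) (by norm_num) (red_facesF _) (red_facesG _)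
    (fun x hx => by
      refine ⟨hM' x (Multiset.mem_cons_of_mem hx), ?_⟩
      have hex := hr'.excludes hx
      obtain ⟨y, hy, rfl⟩ := Multiset.mem_map.1 hx
      have hy' := hM y (Multiset.mem_cons_of_mem hy)
      have j1 : ind (T y) = u := by
        rw [← hu', hT.ind hy' (hM τ hτ)]
        exact i1 y (Multiset.mem_cons_of_mem hy)
      have j2 : ind (rho (T y)) = ind (rho (encTerm 0 u 0 1 c)) := by
        rw [← e, ← hT.rho hy', ← hT.rho (hM τ hτ), hT.ind hy'.rho (hM τ hτ).rho]
        exact i2 y (Multiset.mem_cons_of_mem hy)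
      rw [select_eq, if_pos (Nat.beq_eq.mpr j1), select_eq, if_pos (Nat.beq_eq.mpr j2), hex])
    (by rw [Multiset.card_map]; omega) ((val_facesF_singleton _ _).trans hF)
    ((val_facesG_singleton _ _).trans hG) hs
  exact Bool.false_ne_true h1

/-! ### Cycles of length at most seven -/

/-- The parts of the various degrees of a cycle of length at most seven. -/
structure ShortCycle (N : ℤ → Multiset ℕ) : Prop where
  valid : ∀ k, ∀ τ ∈ N k, Valid τ
  reduced : ∀ k, Reduced (N k)
  closed : ∀ k, Fm (N (k + 1)) = Kap (Fm ((N k).map rho))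
  finite : ∃ K : Finset ℤ, ∀ k ∉ K, N k = 0
  card : ∀ K : Finset ℤ, ∑ k ∈ K, Multiset.card (N k) ≤ 7

theorem Killed.of_map_rho {M : Multiset ℕ} (hM : ∀ τ ∈ M, Valid τ) (h : Killed (M.map rho)) :
    Killed M := by
  intro j
  have h1 := h j
  rw [map_rho_rho hM] at h1
  exact h1.symm

namespace ShortCycle

variable {N : ℤ → Multiset ℕ}

theorem exists_top (h : ShortCycle N) {k : ℤ} (hk : N k ≠ 0) :
    ∃ m, k ≤ m ∧ N m ≠ 0 ∧ ∀ i, m < i → N i = 0 := by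
  obtain ⟨K, hK⟩ := h.finite
  have hmem : ∀ i, N i ≠ 0 → i ∈ K.filter fun i => N i ≠ 0 := fun i hi =>
    Finset.mem_filter.2 ⟨by_contra fun h' => hi (hK i h'), hi⟩
  have hne : (K.filter fun i => N i ≠ 0).Nonempty := ⟨k, hmem k hk⟩
  refine ⟨_, Finset.le_max' _ _ (hmem k hk), (Finset.mem_filter.1 (Finset.max'_mem _ hne)).2,
    fun i hi => ?_⟩
  by_contra h'
  exact absurd (Finset.le_max' _ _ (hmem i h')) (not_le.2 hi)

theorem reverse (h : ShortCycle N) : ShortCycle fun k => (N (-k)).map rho where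
  valid k := valid_map_rho (h.valid _)
  reduced k := (h.reduced _).map_rho (h.valid _)
  closed k := by
    have h1 := h.closed (-(k + 1))
    rw [show -(k + 1) + 1 = -k by ring] at h1
    rw [map_rho_rho (h.valid _), h1, Kap_Kap_Fm (valid_map_rho (h.valid _))]
  finite := by
    obtain ⟨K, hK⟩ := h.finite
    refine ⟨K.image fun k => -k, fun k hk => ?_⟩
    rw [hK (-k) fun hk' => hk (Finset.mem_image.2 ⟨-k, hk', neg_neg k⟩), Multiset.map_zero]
  card K := by
    have h1 := h.card (K.image fun k => -k)
    rw [Finset.sum_image (by simp)] at h1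
    simpa using h1

theorem exists_bottom (h : ShortCycle N) {k : ℤ} (hk : N k ≠ 0) :
    ∃ m, m ≤ k ∧ N m ≠ 0 ∧ ∀ i, i < m → N i = 0 := by
  obtain ⟨m, h1, h2, h3⟩ := h.reverse.exists_top (k := -k) (by simpa using hk)
  refine ⟨-m, by omega, by simpa using h2, fun i hi => ?_⟩
  simpa using h3 (-i) (by omega)

theorem Fm_eq_zero (h : ShortCycle N) {k : ℤ} (hk : N (k - 1) = 0) : Fm (N k) = 0 := by
  have h1 := h.closed (k - 1)
  rw [sub_add_cancel, hk] at h1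
  simpa using h1

theorem Fm_rho_eq_zero (h : ShortCycle N) {k : ℤ} (hk : N (k + 1) = 0) :
    Fm ((N k).map rho) = 0 := by
  have h1 := h.closed k
  rw [hk, Fm_zero] at h1
  rw [← Kap_Kap_Fm (valid_map_rho (h.valid k)), ← h1, map_zero]

theorem killed_of_card_le_three (h : ShortCycle N) {n : ℤ} (hn : N n ≠ 0)
    (hlow : ∀ k, k < n → N k = 0) (hc : Multiset.card (N n) ≤ 3) :
    (∀ k, k ≠ n → k ≠ n + 1 → N k = 0) ∧ Killed (N n + N (n + 1)) := by
  have h2 : ∀ (_ : ℕ) L, testDouble L = true → 2 ≤ L.length := by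
    intro _ L hL
    rw [testDouble, select_eq] at hL
    split_ifs at hL with h1
    exact Nat.le_of_ble_eq_true h1
  obtain ⟨T, D, hT, -, L, h1, hL, -⟩ := exists_start (test := fun _ => testDouble)
    testStart_testDouble h2 (h.valid n) (h.reduced n) hc hn (h.Fm_eq_zero (hlow _ (by omega)))
  have hL2 := h2 0 L h1
  have hcard := congrArg Multiset.card hL
  rw [Multiset.coe_card, Multiset.card_map] at hcard
  rw [testDouble, select_eq, forceList_eq, select_eq] at h1
  split_ifs at h1 with h3 h4
  have hLv : ∀ τ ∈ L, Valid τ := fun τ hτ => hT.valid_map (h.valid n) τ (by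
    rw [← hL]
    exact hτ)
  have hF : val (gFaces L) + Fm ((N (n + 1)).map T) = 0 := by
    rw [val_gFaces, hT.Fm_map (h.valid _), h.closed, hL, hT.map_rho (h.valid _),
      hT.Fm_map (valid_map_rho (h.valid _)), hT.Kap_Fm (valid_map_rho (h.valid _)),
      neg_add_cancel]
  have hpair := h.card {n, n + 1}
  rw [Finset.sum_pair (by omega)] at hpair
  have hhigh : ∀ k, n + 1 < k → N k = 0 := by
    intro k hk
    by_contra hk0
    obtain ⟨m, hkm, hm0, hm⟩ := h.exists_top hk0
    have hm2 : 2 ≤ Multiset.card (N m) := by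
      by_contra h'
      have := eq_zero_of_Fm_eq_zero (valid_map_rho (h.valid m))
        (by rw [Multiset.card_map]; omega) (h.Fm_rho_eq_zero (hm _ (by omega)))
      exact hm0 (Multiset.map_eq_zero.1 this)
    have htriple := h.card {n, n + 1, m}
    rw [Finset.sum_insert (by simp; omega), Finset.sum_pair (by omega)] at htriple
    obtain ⟨L', M', h5, -⟩ := fill_sound (by omega) (red_gFaces hLv)
      (fun τ hτ => ⟨hT.valid_map (h.valid _) τ hτ, rfl⟩) (by rw [Multiset.card_map]; omega) hF h4
    exact Bool.false_ne_true h5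
  refine ⟨fun k hk hk' => ?_, ?_⟩
  · rcases lt_or_gt_of_ne hk with hk | hk
    · exact hlow k hk
    · exact hhigh k (by omega)
  obtain ⟨L', M', h5, h6, h7, h8, h9⟩ := search_sound (by omega) (red_gFaces hLv) red_nil
    (fun τ hτ => ⟨hT.valid_map (h.valid _) τ hτ, rfl⟩) (by rw [Multiset.card_map]; omega) hF (by
      rw [val_nil, zero_add, hT.map_rho (h.valid _), hT.Fm_map (valid_map_rho (h.valid _)),
        h.Fm_rho_eq_zero (hhigh _ (by omega)), map_zero]) h1
  have hM' : M' = 0 := by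
    have hle := Multiset.card_le_card h9
    rw [Multiset.card_map] at hle
    exact eq_zero_of_closed
      (fun τ hτ => hT.valid_map (h.valid _) τ (Multiset.mem_of_le h9 hτ))
      ((hT.reduced_map (h.valid _) (h.reduced _)).mono h9) (by omega) h7 h8
  have h10 := killed_of_zetaTest h5
  rw [hM', add_zero, Multiset.coe_nil, zero_add] at h6
  rw [← Multiset.coe_add, h6, hL, add_comm, ← Multiset.map_add] at h10
  refine hT.killed (fun τ hτ => ?_) h10
  rcases Multiset.mem_add.1 hτ with hτ | hτ
  · exact h.valid _ τ hτ
  · exact h.valid _ τ hτ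

theorem exists_killed (h : ShortCycle N) :
    ∃ n, (∀ k, k ≠ n → k ≠ n + 1 → N k = 0) ∧ Killed (N n + N (n + 1)) := by
  by_cases h0 : ∀ k, N k = 0
  · refine ⟨0, fun k _ _ => h0 k, fun j => ?_⟩
    simp [h0, zm]
  push Not at h0
  obtain ⟨k, hk⟩ := h0
  obtain ⟨n, hnk, hn0, hn⟩ := h.exists_bottom hk
  obtain ⟨m, hkm, hm0, hm⟩ := h.exists_top hk
  by_cases hc : Multiset.card (N n) ≤ 3
  · exact ⟨n, h.killed_of_card_le_three hn0 hn hc⟩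
  have hnm : n ≠ m := by
    rintro rfl
    have h7 := h.card {n}
    rw [Finset.sum_singleton] at h7
    exact hn0 (eq_zero_of_closed (h.valid n) (h.reduced n) h7
      (h.Fm_eq_zero (hn _ (by omega))) (h.Fm_rho_eq_zero (hm _ (by omega))))
  have h7 := h.card {n, m}
  rw [Finset.sum_pair hnm] at h7
  obtain ⟨h1, h2⟩ := h.reverse.killed_of_card_le_three (n := -m) (by simpa using hm0)
    (fun k hk => by simp [hm (-k) (by omega)]) (by simp; omega)
  refine ⟨m - 1, fun k hk hk' => ?_, ?_⟩
  · simpa using h1 (-k) (by omega) (by omega)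
  · rw [sub_add_cancel, add_comm]
    refine Killed.of_map_rho (fun τ hτ => ?_) ?_
    · rcases Multiset.mem_add.1 hτ with hτ | hτ
      · exact h.valid _ τ hτ
      · exact h.valid _ τ hτ
    · rw [Multiset.map_add]
      simpa [show -(-m + 1) = m - 1 by ring, neg_add_eq_sub] using h2

theorem sum_zm_eq_zero (h : ShortCycle N) {K : Finset ℤ} (hK : ∀ k ∉ K, N k = 0) :
    ∑ k ∈ K, zm 0 (N k) = 0 := by
  obtain ⟨n, h1, h2⟩ := h.exists_killed
  have h3 : ∑ k ∈ K, zm 0 (N k) = ∑ k ∈ K ∪ {n, n + 1}, zm 0 (N k) :=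
    Finset.sum_subset Finset.subset_union_left fun k _ hk => by simp [hK k hk, zm]
  have h4 : ∑ k ∈ {n, n + 1}, zm 0 (N k) = ∑ k ∈ K ∪ {n, n + 1}, zm 0 (N k) :=
    Finset.sum_subset Finset.subset_union_right fun k _ hk => by
      simp only [Finset.mem_insert, Finset.mem_singleton, not_or] at hk
      simp [h1 k hk.1 hk.2, zm]
  rw [h3, ← h4, Finset.sum_pair (by omega), ← zm_add, (h2 0).1]

end ShortCycle

/-! ### From chains to multisets of signed terms -/

set_option linter.deprecated false in
theorem chain_iff {X : Type*} (l : List X) : l.Chain' (· ≠ ·) ↔ l.IsChain (· ≠ ·) := Iff.rfl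

theorem gen_pair {X S : Type*} [DecidableEq X] (s : S) (x y : X) :
    gen s [x, y] = if h : x ≠ y then
      Finsupp.single ⟨(s, [x, y]), (chain_iff _).2 (by simpa using h)⟩ 1 else 0 := by
  unfold gen
  by_cases h : x = y <;> simp [h, chain_iff]

theorem val_R7op (a b : ZMod 7) : (R7op a b).val = (2 * b.val + 6 * a.val) % 7 := by
  revert a b
  decide

/-- The signed term of a generator of length three. -/
def code (σ : ℕ) (t : Gen (ZMod 7) (ℤ × ZMod 7)) : ℕ :=
  match t.1.2 with
  | [a, b, c] => encTerm σ t.1.1.2.val a.val b.val c.val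
  | _ => 0

theorem exists_eq_of_length {t : Gen (ZMod 7) (ℤ × ZMod 7)} (ht : t.1.2.length = 3) :
    ∃ n u a b c, ∃ h, a ≠ b ∧ b ≠ c ∧ t = ⟨((n, u), [a, b, c]), h⟩ := by
  obtain ⟨⟨⟨n, u⟩, l⟩, h⟩ := t
  obtain ⟨a, b, c, rfl⟩ := List.length_eq_three.1 ht
  have hc := (chain_iff _).1 h
  simp only [List.isChain_cons_cons] at hc
  exact ⟨n, u, a, b, c, h, hc.1, hc.2.1, rfl⟩

theorem code_mk (σ : ℕ) (n : ℤ) (u a b c : ZMod 7) (h) :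
    code σ ⟨((n, u), [a, b, c]), h⟩ = encTerm σ u.val a.val b.val c.val := rfl

theorem valid_code {σ : ℕ} (hσ : σ < 2) {t : Gen (ZMod 7) (ℤ × ZMod 7)} (ht : t.1.2.length = 3) :
    Valid (code σ t) := by
  obtain ⟨n, u, a, b, c, h, hab, hbc, rfl⟩ := exists_eq_of_length ht
  exact valid_encTerm hσ u.val_lt a.val_lt b.val_lt c.val_lt
    (fun e => hab (ZMod.val_injective 7 e)) (fun e => hbc (ZMod.val_injective 7 e))

theorem opp_code {σ : ℕ} (hσ : σ < 2) {t : Gen (ZMod 7) (ℤ × ZMod 7)} (ht : t.1.2.length = 3) :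
    opp (code σ t) = code (1 - σ) t := by
  obtain ⟨n, u, a, b, c, h, hab, hbc, rfl⟩ := exists_eq_of_length ht
  exact opp_encTerm _ _ _ _ hσ

theorem eq_of_code_eq {σ σ' : ℕ} (hσ : σ < 2) (hσ' : σ' < 2) {t t' : Gen (ZMod 7) (ℤ × ZMod 7)}
    (ht : t.1.2.length = 3) (ht' : t'.1.2.length = 3) (hd : t.1.1.1 = t'.1.1.1)
    (h : code σ t = code σ' t') : σ = σ' ∧ t = t' := by
  obtain ⟨n, u, a, b, c, _, _, _, rfl⟩ := exists_eq_of_length ht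
  obtain ⟨n', u', a', b', c', _, _, _, rfl⟩ := exists_eq_of_length ht'
  obtain rfl : n = n' := hd
  simp only [code_mk, encTerm_eq] at h
  have := u.val_lt
  have := u'.val_lt
  have := a.val_lt
  have := a'.val_lt
  have := b.val_lt
  have := b'.val_lt
  have := c.val_lt
  have := c'.val_lt
  obtain rfl : u = u' := ZMod.val_injective 7 (by omega)
  obtain rfl : a = a' := ZMod.val_injective 7 (by omega)
  obtain rfl : b = b' := ZMod.val_injective 7 (by omega)
  obtain rfl : c = c' := ZMod.val_injective 7 (by omega)
  exact ⟨by omega, rfl⟩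

def signOf (z : ℤ) : ℕ := if 0 < z then 0 else 1

theorem signOf_lt (z : ℤ) : signOf z < 2 := by
  unfold signOf
  split_ifs <;> simp

/-- The signed terms of degree `k` of a chain, with multiplicity. -/
noncomputable def termsAt (γ : Ch (ZMod 7) (ℤ × ZMod 7)) (k : ℤ) : Multiset ℕ :=
  ∑ t ∈ γ.support,
    if t.1.1.1 = k then Multiset.replicate (γ t).natAbs (code (signOf (γ t)) t) else 0

section Chain

variable {γ : Ch (ZMod 7) (ℤ × ZMod 7)}

theorem mem_termsAt {k : ℤ} {τ : ℕ} (h : τ ∈ termsAt γ k) :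
    ∃ t ∈ γ.support, t.1.1.1 = k ∧ τ = code (signOf (γ t)) t := by
  obtain ⟨t, ht, h⟩ := Multiset.mem_sum.1 h
  split_ifs at h with hk
  · exact ⟨t, ht, hk, Multiset.eq_of_mem_replicate h⟩
  · simp at h

theorem valid_of_mem_termsAt (hγ : IsMChain 3 γ) {k : ℤ} {τ : ℕ} (h : τ ∈ termsAt γ k) :
    Valid τ := by
  obtain ⟨t, ht, -, rfl⟩ := mem_termsAt h
  exact valid_code (signOf_lt _) (hγ t ht)

theorem reduced_termsAt (hγ : IsMChain 3 γ) (k : ℤ) : Reduced (termsAt γ k) := by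
  intro τ hτ hτ'
  obtain ⟨t, ht, hk, rfl⟩ := mem_termsAt hτ
  obtain ⟨t', ht', hk', h⟩ := mem_termsAt hτ'
  have hs := signOf_lt (γ t)
  rw [opp_code hs (hγ t ht)] at h
  obtain ⟨h, rfl⟩ := eq_of_code_eq (by omega) (signOf_lt _) (hγ t ht) (hγ t' ht')
    (hk.trans hk'.symm) h
  omega

theorem sum_card_termsAt_le (K : Finset ℤ) :
    ∑ k ∈ K, Multiset.card (termsAt γ k) ≤ chainLen γ := by
  have hcard (k : ℤ) : Multiset.card (termsAt γ k) =
      ∑ t ∈ γ.support, if t.1.1.1 = k then (γ t).natAbs else 0 := by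
    refine (map_sum Multiset.cardHom _ _).trans (Finset.sum_congr rfl fun t _ => ?_)
    change Multiset.card _ = _
    split_ifs <;> simp
  rw [Finset.sum_congr rfl fun k _ => hcard k, Finset.sum_comm]
  refine Finset.sum_le_sum fun t _ => ?_
  rw [Finset.sum_ite_eq]
  split_ifs <;> simp

theorem termsAt_eq_zero {k : ℤ} (hk : k ∉ γ.support.image fun t => t.1.1.1) :
    termsAt γ k = 0 := by
  refine Finset.sum_eq_zero fun t ht => if_neg ?_
  rintro rfl
  exact hk (Finset.mem_image_of_mem _ ht)

theorem sum_map_termsAt {A : Type*} [AddCommGroup A] (hγ : IsMChain 3 γ) {φ : ℕ → A}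
    (hφ : ∀ τ, Valid τ → φ (opp τ) = -φ τ) (k : ℤ) :
    ((termsAt γ k).map φ).sum = γ.sum fun t c => if t.1.1.1 = k then c • φ (code 0 t) else 0 := by
  have hsum : ((termsAt γ k).map φ).sum = ∑ t ∈ γ.support,
      ((if t.1.1.1 = k then Multiset.replicate (γ t).natAbs (code (signOf (γ t)) t)
        else 0).map φ).sum :=
    map_sum (Multiset.sumAddMonoidHom.comp (Multiset.mapAddMonoidHom φ)) _ _
  rw [hsum, Finsupp.sum]
  refine Finset.sum_congr rfl fun t ht => ?_
  split_ifs
  · rw [Multiset.map_replicate, Multiset.sum_replicate, ← natCast_zsmul]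
    unfold signOf
    split_ifs with hpos
    · rw [Int.natAbs_of_nonneg hpos.le]
    · have h1 : code 1 t = opp (code 0 t) := (opp_code zero_lt_two (hγ t ht)).symm
      rw [h1, hφ _ (valid_code zero_lt_two (hγ t ht)), Int.ofNat_natAbs_of_nonpos (by omega),
        neg_smul, smul_neg, neg_neg]
  · simp

end Chain

/-! ### Boundaries of chains -/

/-- The face of degree `k` encoded by a generator of length two. -/
noncomputable def faceVal (k : ℤ) (t : Gen (ZMod 7) (ℤ × ZMod 7)) : ℕ →₀ ℤ :=
  match t.1.2 with
  | [x, y] => if t.1.1.1 = k then sv (encFace 0 t.1.1.2.val x.val y.val) else 0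
  | _ => 0

theorem linearCombination_faceVal_gen (k n : ℤ) (v x y : ZMod 7) :
    Finsupp.linearCombination ℤ (faceVal k) (gen (n, v) [x, y]) =
      if n = k ∧ x ≠ y then sv (encFace 0 v.val x.val y.val) else 0 := by
  rw [gen_pair]
  by_cases h : x = y
  · simp [h]
  · simp [h, faceVal, Finsupp.linearCombination_single]

theorem sv_encFace_one (v x y : ℕ) : sv (encFace 1 v x y) = -sv (encFace 0 v x y) := by
  rw [← sv_opp, opp_encFace _ _ _ (by simp)]

theorem fOn_mk (n : ℤ) (u a b c : ZMod 7) (h) :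
    fOn ⟨((n, u), [a, b, c]), h⟩ =
      -gen (n, u) [b, c] + gen (n, u) [a, c] - gen (n, u) [a, b] := by
  simp [fOn, Fin.sum_univ_succ]
  abel

theorem gOn_mk (n : ℤ) (u a b c : ZMod 7) (h) :
    gOn R7op (zact R7op) ⟨((n, u), [a, b, c]), h⟩ =
      gen (n + 1, R7op u a) [b, c] - gen (n + 1, R7op u b) [R7op a b, c] +
        gen (n + 1, R7op u c) [R7op a c, R7op b c] := by
  simp [gOn, Fin.sum_univ_succ, zact]
  abel

theorem fv_encTerm {a b c : ℕ} (u : ℕ) (ha : a < 7) (hb : b < 7) (hc : c < 7) :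
    fv (encTerm 0 u a b c) = -sv (encFace 0 u b c) - sv (encFace 0 u a b) +
      if a = c then 0 else sv (encFace 0 u a c) := by
  rw [fv, faces_encTerm u zero_lt_two ha hb hc, val_cons, val_cons, Nat.sub_zero,
    sv_encFace_one, sv_encFace_one]
  split_ifs
  · simp only [val_nil]
    abel
  · simp only [val_cons, val_nil]
    abel

theorem linearCombination_fOn (k : ℤ) {t : Gen (ZMod 7) (ℤ × ZMod 7)} (ht : t.1.2.length = 3) :
    Finsupp.linearCombination ℤ (faceVal k) (fOn t) =
      if t.1.1.1 = k then fv (code 0 t) else 0 := by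
  obtain ⟨n, u, a, b, c, h, hab, hbc, rfl⟩ := exists_eq_of_length ht
  rw [fOn_mk, map_sub, map_add, map_neg, code_mk, fv_encTerm _ a.val_lt b.val_lt c.val_lt]
  simp only [linearCombination_faceVal_gen, (ZMod.val_injective 7).eq_iff]
  by_cases hn : n = k <;> by_cases hac : a = c <;> simp [hn, hab, hac, hbc, hbc.symm]
  all_goals try abel

theorem linearCombination_gOn (k : ℤ) {t : Gen (ZMod 7) (ℤ × ZMod 7)} (ht : t.1.2.length = 3) :
    Finsupp.linearCombination ℤ (faceVal k) (gOn R7op (zact R7op) t) =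
      if t.1.1.1 + 1 = k then -Kap (fv (rho (code 0 t))) else 0 := by
  obtain ⟨n, u, a, b, c, h, hab, hbc, rfl⟩ := exists_eq_of_length ht
  have ha := a.val_lt
  have hb := b.val_lt
  have hc := c.val_lt
  have hu := u.val_lt
  have hne (x y z : ZMod 7) : R7op x z = R7op y z ↔ x = y := by
    revert x y z
    decide
  have hac : R7op a b = c ↔ (a.val + (5 * b.val + 2 * c.val)) % 7 = c.val := by
    rw [← (ZMod.val_injective 7).eq_iff, val_R7op]
    omega
  rw [gOn_mk, map_add, map_sub, code_mk, rho_encTerm _ zero_lt_two ha hb hc,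
    fv_encTerm _ (Nat.mod_lt _ (by simp)) (Nat.mod_lt _ (by simp)) hc, map_add, map_sub, map_neg,
    apply_ite Kap, map_zero]
  simp only [linearCombination_faceVal_gen, Kap_sv, ne_eq, hne, hac, hab, hbc, val_R7op]
  rw [kap_encFace _ zero_lt_two (Nat.mod_lt _ (by simp)) hc,
    kap_encFace _ zero_lt_two (Nat.mod_lt _ (by simp)) (Nat.mod_lt _ (by simp)),
    kap_encFace _ zero_lt_two (Nat.mod_lt _ (by simp)) hc]
  have hbc' : encFace 0 ((2 * a.val + 6 * u.val) % 7) b.val c.val =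
      encFace 0 (((2 * a.val + (5 * b.val + (2 * c.val + 6 * u.val))) % 7 +
        (2 * c.val + 5 * ((2 * c.val + 6 * b.val) % 7))) % 7)
        ((2 * c.val + 6 * ((2 * c.val + 6 * b.val) % 7)) % 7) c.val := by
    congr 1 <;> omega
  have hac' : encFace 0 ((2 * b.val + 6 * u.val) % 7) ((2 * b.val + 6 * a.val) % 7) c.val =
      encFace 0 (((2 * a.val + (5 * b.val + (2 * c.val + 6 * u.val))) % 7 +
        (2 * c.val + 5 * ((a.val + (5 * b.val + 2 * c.val)) % 7))) % 7)
        ((2 * c.val + 6 * ((a.val + (5 * b.val + 2 * c.val)) % 7)) % 7) c.val := by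
    congr 1 <;> omega
  have hab' : encFace 0 ((2 * c.val + 6 * u.val) % 7) ((2 * c.val + 6 * a.val) % 7)
      ((2 * c.val + 6 * b.val) % 7) =
      encFace 0 (((2 * a.val + (5 * b.val + (2 * c.val + 6 * u.val))) % 7 +
        (2 * ((2 * c.val + 6 * b.val) % 7) + 5 * ((a.val + (5 * b.val + 2 * c.val)) % 7))) % 7)
        ((2 * ((2 * c.val + 6 * b.val) % 7) + 6 * ((a.val + (5 * b.val + 2 * c.val)) % 7)) % 7)
        ((2 * c.val + 6 * b.val) % 7) := by
    congr 1 <;> omega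
  rw [← hbc', ← hac', ← hab']
  by_cases hn : n + 1 = k <;> simp only [hn, not_false_eq_true, and_self, true_and, false_and,
    if_true, if_false]
  · split_ifs <;> abel
  · abel

theorem zetaFun_eq (a b c : ZMod 7) :
    zetaFun a b c = (a - b) * (2 * (3 * c ^ 5 * (b - c) ^ 2 + 5 * c ^ 3 * (b - c) ^ 4 +
      c * (b - c) ^ 6)) := by
  revert a b c
  decide +kernel

/-! ### The length of a cycle -/

theorem fmap_add (γ δ : Ch X S) : fmap (γ + δ) = fmap γ + fmap δ :=
  Finsupp.sum_add_index' (by simp) fun t a b => add_smul a b (fOn t)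

theorem gmap_add (op : X → X → X) (sact : S → X → S) (γ δ : Ch X S) :
    gmap op sact (γ + δ) = gmap op sact γ + gmap op sact δ :=
  Finsupp.sum_add_index' (by simp) fun t a b => add_smul a b (gOn op sact t)

section Cycle

variable {γ : Ch (ZMod 7) (ℤ × ZMod 7)}

theorem Fm_termsAt (hγ : IsMChain 3 γ) (hb : bd R7op (zact R7op) γ = 0) (k : ℤ) :
    Fm (termsAt γ (k + 1)) = Kap (Fm ((termsAt γ k).map rho)) := by
  have hF : Finsupp.linearCombination ℤ (faceVal (k + 1)) (fmap γ) = Fm (termsAt γ (k + 1)) := by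
    rw [Fm, sum_map_termsAt hγ (fun τ hτ => fv_opp hτ), fmap, map_finsuppSum]
    refine Finset.sum_congr rfl fun t ht => ?_
    dsimp only
    rw [map_zsmul, linearCombination_fOn _ (hγ t ht), smul_ite, smul_zero]
  have hG : Finsupp.linearCombination ℤ (faceVal (k + 1)) (gmap R7op (zact R7op) γ) =
      -Kap (Fm ((termsAt γ k).map rho)) := by
    have hodd (τ : ℕ) (hτ : Valid τ) : -Kap (fv (rho (opp τ))) = -(-Kap (fv (rho τ))) := by
      rw [rho_opp hτ, fv_opp hτ.rho, map_neg]
    have hsum : -Kap (Fm ((termsAt γ k).map rho)) =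
        ((termsAt γ k).map fun τ => -Kap (fv (rho τ))).sum := by
      rw [Fm, Multiset.map_map, map_multiset_sum, Multiset.map_map, ← Multiset.sum_map_neg]
      rfl
    rw [hsum, sum_map_termsAt hγ hodd, gmap, map_finsuppSum]
    refine Finset.sum_congr rfl fun t ht => ?_
    dsimp only
    rw [map_zsmul, linearCombination_gOn _ (hγ t ht), smul_ite, smul_zero]
    simp only [add_left_inj]
  rw [← sub_eq_zero, sub_eq_add_neg, ← hF, ← hG, ← map_add]
  exact (congrArg _ hb).trans (map_zero _)

theorem shortCycle_termsAt (hγ : IsMChain 3 γ) (hb : bd R7op (zact R7op) γ = 0)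
    (hl : chainLen γ ≤ 7) : ShortCycle (termsAt γ) where
  valid _ _ h := valid_of_mem_termsAt hγ h
  reduced := reduced_termsAt hγ
  closed := Fm_termsAt hγ hb
  finite := ⟨_, fun _ hk => termsAt_eq_zero hk⟩
  card K := (sum_card_termsAt_le K).trans hl

/-- Evaluation of a cochain on chains, as a homomorphism. -/
noncomputable def evalHom {A : Type*} [AddCommGroup A] (θ : List X → A) : Ch X S →+ A :=
  Finsupp.liftAddHom fun t => (zmultiplesHom A) (θ t.1.2)

theorem evalHom_gen {A : Type*} [AddCommGroup A] (θ : List X → A) (s : S) {l : List X}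
    (hl : l.IsChain (· ≠ ·)) : evalHom θ (gen s l) = θ l := by
  have h := (chain_iff l).2 hl
  simp [gen, evalHom, h]

theorem evalCh_proj {A : Type*} [AddCommGroup A] (θ : List X → A) (γ : Ch X S) :
    evalCh θ (proj γ) = evalHom θ γ := by
  change evalHom θ (proj γ) = evalHom θ γ
  rw [proj, map_finsuppSum]
  refine Finset.sum_congr rfl fun t _ => ?_
  dsimp only
  rw [map_zsmul, evalHom_gen _ _ ((chain_iff _).1 t.2)]
  rfl

theorem evalCh_proj_eq_sum (hγ : IsMChain 3 γ) :
    evalCh zetaL (proj γ) = ∑ k ∈ γ.support.image fun t => t.1.1.1, zm 0 (termsAt γ k) := by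
  have hodd (τ : ℕ) (hτ : Valid τ) : (zetaNat 0 (opp τ) : ZMod 7) = -(zetaNat 0 τ : ZMod 7) := by
    obtain ⟨σ, u, a, b, c, hσ, -, ha, hb, hc, -, -, rfl⟩ := hτ
    rw [opp_encTerm _ _ _ _ hσ, zetaNat_encTerm _ _ (by omega) ha hb hc,
      zetaNat_encTerm _ _ hσ ha hb hc]
    have h6 : (6 : ZMod 7) = -1 := by decide
    interval_cases σ <;> simp [h6]
  have hzm (k : ℤ) := sum_map_termsAt (φ := fun τ => (zetaNat 0 τ : ZMod 7)) hγ hodd k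
  simp only [zm, hzm, Finsupp.sum]
  rw [evalCh_proj, Finset.sum_comm]
  refine Finset.sum_congr rfl fun t ht => ?_
  rw [Finset.sum_ite_eq, if_pos (Finset.mem_image_of_mem _ ht)]
  obtain ⟨n, u, a, b, c, h, -, -, ht'⟩ := exists_eq_of_length (hγ t ht)
  rw [ht', code_mk, zetaNat_encTerm _ _ zero_lt_two a.val_lt b.val_lt c.val_lt]
  simp only [ZMod.natCast_val, ZMod.cast_id', id, if_true, Nat.cast_zero, add_zero, one_mul]
  change γ _ • zetaFun a b c = _
  rw [zetaFun_eq]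

theorem evalCh_eq_zero (hγ : IsMChain 3 γ) (hb : bd R7op (zact R7op) γ = 0)
    (hl : chainLen γ ≤ 7) : evalCh zetaL (proj γ) = 0 :=
  (evalCh_proj_eq_sum hγ).trans
    ((shortCycle_termsAt hγ hb hl).sum_zm_eq_zero fun _ hk => termsAt_eq_zero hk)

end Cycle

/-! ### The explicit cycle -/

set_option linter.deprecated false in
theorem fmap_gen (n : ℤ) (u : ZMod 7) {a b c : ZMod 7} (h : [a, b, c].Chain' (· ≠ ·)) :
    fmap (gen (n, u) [a, b, c]) = fOn ⟨((n, u), [a, b, c]), h⟩ := by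
  simp [fmap, gen, h]

set_option linter.deprecated false in
theorem gmap_gen (op : ZMod 7 → ZMod 7 → ZMod 7) (sact : ℤ × ZMod 7 → ZMod 7 → ℤ × ZMod 7)
    (n : ℤ) (u : ZMod 7) {a b c : ZMod 7} (h : [a, b, c].Chain' (· ≠ ·)) :
    gmap op sact (gen (n, u) [a, b, c]) = gOn op sact ⟨((n, u), [a, b, c]), h⟩ := by
  simp [gmap, gen, h]

noncomputable def bdHom : Ch (ZMod 7) (ℤ × ZMod 7) →+ Ch (ZMod 7) (ℤ × ZMod 7) :=
  AddMonoidHom.mk' fmap fmap_add + AddMonoidHom.mk' (gmap R7op (zact R7op)) (gmap_add _ _)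

set_option linter.deprecated false in
theorem bdHom_gen (n : ℤ) (u : ZMod 7) {a b c : ZMod 7} (hab : a ≠ b) (hbc : b ≠ c) :
    bdHom (gen (n, u) [a, b, c]) =
      -gen (n, u) [b, c] + gen (n, u) [a, c] - gen (n, u) [a, b] +
        (gen (n + 1, R7op u a) [b, c] - gen (n + 1, R7op u b) [R7op a b, c] +
          gen (n + 1, R7op u c) [R7op a c, R7op b c]) := by
  have h : [a, b, c].Chain' (· ≠ ·) := (chain_iff _).2 (by simp [hab, hbc])
  rw [← fOn_mk n u a b c h, ← gOn_mk n u a b c h, ← fmap_gen, ← gmap_gen]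
  rfl

theorem gen_self (s : S) (x : X) : gen s [x, x] = 0 := by
  classical
  rw [gen_pair, dif_neg (by simp)]

theorem isMChain_gen (s : S) (l : List X) : IsMChain l.length (gen s l) := by
  intro t ht
  unfold gen at ht
  split_ifs at ht
  · rw [Finset.mem_singleton.1 (Finsupp.support_single_subset ht)]
  · simp at ht

theorem IsMChain.add {m : ℕ} {γ δ : Ch X S} (hγ : IsMChain m γ) (hδ : IsMChain m δ) :
    IsMChain m (γ + δ) := by
  classical
  exact fun t ht => (Finset.mem_union.1 (Finsupp.support_add ht)).elim (hγ t) (hδ t)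

theorem IsMChain.sub {m : ℕ} {γ δ : Ch X S} (hγ : IsMChain m γ) (hδ : IsMChain m δ) :
    IsMChain m (γ - δ) := by
  classical
  exact fun t ht => (Finset.mem_union.1 (Finsupp.support_sub ht)).elim (hγ t) (hδ t)

theorem isMChain_gammaR7 : IsMChain 3 gammaR7 := by
  have h (s : ℤ × ZMod 7) (a b c : ZMod 7) : IsMChain 3 (gen s [a, b, c]) := isMChain_gen s _
  rw [gammaR7]
  exact (((((((h _ _ _ _).sub (h _ _ _ _)).sub (h _ _ _ _)).add (h _ _ _ _)).add
    (h _ _ _ _)).sub (h _ _ _ _)).sub (h _ _ _ _)).add (h _ _ _ _)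

theorem evalCh_gammaR7 : evalCh zetaL (proj gammaR7) = 6 := by
  rw [evalCh_proj, gammaR7]
  simp only [map_add, map_sub]
  iterate 8 rw [evalHom_gen _ _ (by decide)]
  decide

theorem bd_gammaR7 : bd R7op (zact R7op) gammaR7 = 0 := by
  change bdHom gammaR7 = 0
  rw [gammaR7]
  simp only [map_add, map_sub]
  iterate 8 rw [bdHom_gen _ _ (by decide) (by decide)]
  have h (a b d : ZMod 7) (e : R7op a b = d) : R7op a b = d := e
  simp only [h 0 0 0 rfl, h 0 1 2 rfl, h 0 6 5 rfl, h 1 0 6 rfl, h 1 4 0 rfl, h 1 6 4 rfl,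
    h 2 0 5 rfl, h 2 2 2 rfl, h 2 3 4 rfl, h 2 6 3 rfl, h 3 0 4 rfl, h 4 0 3 rfl, h 5 0 2 rfl,
    h 5 1 4 rfl, h 5 4 3 rfl, h 5 5 5 rfl, h 6 0 1 rfl, h 6 1 3 rfl, h 6 3 0 rfl, gen_self,
    zero_add]
  abel

/-- `l(ζ, ℤ × R₇) ≥ 8`. -/
theorem lower_bound_length_zeta_R7 :
    (IsMChain 3 gammaR7 ∧ bd R7op (zact R7op) gammaR7 = 0 ∧
      evalCh zetaL (proj gammaR7) = 6 ∧ (6 : ZMod 7) ≠ 0) ∧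
    ∀ γ : Ch (ZMod 7) (ℤ × ZMod 7), IsMChain 3 γ → bd R7op (zact R7op) γ = 0 →
      evalCh zetaL (proj γ) ≠ 0 → 8 ≤ chainLen γ := by
  refine ⟨⟨isMChain_gammaR7, bd_gammaR7, evalCh_gammaR7, by decide⟩, fun γ hγ hb hz => ?_⟩
  by_contra hl
  exact hz (evalCh_eq_zero hγ hb (by omega))

end QHom
end

section
/- Let X be a quandle, n an integer, k a positive integer, and γ_i = ε_i(n, u_i; a_i, b_i, c_i) (1 ≤ i ≤ k) 3-terms of (X, ℤ×X) of degree n. Then: (i) γ_1,…,γ_k are g-connected if and only if their reverses γ̄_1,…,γ̄_k are f-connected (as 3-terms of (X̄, ℤ×X̄)); (ii) if γ_1,…,γ_k are f-connected, then u_1 = u_2 = … = u_k; (iii) if γ_1,…,γ_k are g-connected, then u_1^{a_1 b_1 c_1} = u_2^{a_2 b_2 c_2} = … = u_k^{a_k b_k c_k}. -/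
namespace QHom

variable {X S : Type*}

lemma fmap_eq_linearCombination (γ : Ch X S) : fmap γ = Finsupp.linearCombination ℤ fOn γ :=
  rfl

lemma gmap_eq_linearCombination (op : X → X → X) (sact : S → X → S) (γ : Ch X S) :
    gmap op sact γ = Finsupp.linearCombination ℤ (gOn op sact) γ :=
  rfl

/-! ### The maps preserve the `S`-coordinate -/

open Classical in
lemma filter_gen (q : S → Prop) (s : S) (l : List X) :
    Finsupp.filter (fun t : Gen X S => q t.1.1) (gen s l) = if q s then gen s l else 0 := by
  unfold gen
  by_cases hl : l.Chain' (· ≠ ·) <;> by_cases hq : q s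
  · simp [hl, hq, Finsupp.filter_single_of_pos]
  · simp [hl, hq, Finsupp.filter_single_of_neg]
  · simpa [hl, hq] using Finsupp.filter_zero _
  · simpa [hl, hq] using Finsupp.filter_zero _

open Classical in
lemma filter_fOn (q : S → Prop) (t : Gen X S) :
    Finsupp.filter (fun t : Gen X S => q t.1.1) (fOn t) = if q t.1.1 then fOn t else 0 := by
  unfold fOn
  rw [Finsupp.filter_sum]
  simp only [Finsupp.filter_smul, filter_gen]
  split_ifs <;> simp

open Classical in
/-- `f` commutes with restriction to the generators whose `S`-coordinate satisfies `q`. -/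
lemma filter_fmap (q : S → Prop) (γ : Ch X S) :
    Finsupp.filter (fun t : Gen X S => q t.1.1) (fmap γ) =
      fmap (Finsupp.filter (fun t : Gen X S => q t.1.1) γ) := by
  simp only [fmap_eq_linearCombination]
  induction γ using Finsupp.induction_linear with
  | zero => simp only [map_zero, Finsupp.filter_zero]
  | add x y hx hy => simp only [map_add, Finsupp.filter_add, hx, hy]
  | single t c =>
    rw [Finsupp.linearCombination_single, Finsupp.filter_smul, filter_fOn]
    by_cases hq : q t.1.1 <;> simp [hq, Finsupp.filter_single_of_pos, Finsupp.filter_single_of_neg]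

/-- Multiples of generators that are `f`-connected share their `S`-coordinate. -/
lemma FConnected.base_eq {k : ℕ} {γ : Fin k → Ch X S} (h : FConnected γ) {ε : Fin k → ℤ}
    {s : Fin k → S} {l : Fin k → List X} (hγ : ∀ i, γ i = ε i • gen (s i) (l i)) (i j : Fin k) :
    s i = s j := by
  classical
  obtain ⟨-, hsum, hmin⟩ := h
  have hfilter : ∀ i, Finsupp.filter (fun t : Gen X S => t.1.1 = s j) (fmap (γ i)) =
      if s i = s j then fmap (γ i) else 0 := by
    intro i
    rw [filter_fmap (fun x => x = s j), hγ, Finsupp.filter_smul, filter_gen (fun x => x = s j)]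
    split_ifs
    · rfl
    · simp [fmap]
  have hzero : ∑ i ∈ Finset.univ.filter (fun i => s i = s j), fmap (γ i) = 0 := by
    rw [Finset.sum_filter, ← Finset.sum_congr rfl fun i _ => hfilter i, ← Finsupp.filter_sum, hsum,
      Finsupp.filter_zero]
  by_contra hne
  refine hmin _ ⟨j, by simp⟩ (fun huniv => hne ?_) hzero
  have hi := Finset.mem_univ i
  rw [← huniv] at hi
  exact (Finset.mem_filter.mp hi).2

/-! ### Reversing tuples -/

@[simp]
lemma length_revList (op : X → X → X) (l : List X) : (revList op l).length = l.length := by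
  induction l with
  | nil => rfl
  | cons a l ih => simp [revList, ih]

lemma foldl_op_injective (Q : QuandleStr X) (l : List X) :
    Function.Injective fun u => l.foldl Q.op u := by
  induction l with
  | nil => exact fun _ _ h => h
  | cons a l ih => exact ih.comp (Q.bij a).1

lemma isChain_revList (Q : QuandleStr X) (l : List X) :
    (revList Q.op l).Chain' (· ≠ ·) ↔ l.Chain' (· ≠ ·) := by
  induction l with
  | nil => rfl
  | cons a l ih =>
    cases l with
    | nil => simp [revList, List.Chain']
    | cons b l =>
      have hab : l.foldl Q.op (Q.op a b) = l.foldl Q.op b ↔ a = b := by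
        rw [(foldl_op_injective Q l).eq_iff]
        nth_rewrite 2 [← Q.idem b]
        exact (Q.bij b).1.eq_iff
      simp only [List.Chain', revList, List.isChain_cons_cons, List.foldl_cons, ne_eq, hab] at ih ⊢
      rw [ih]

lemma revList_injective (Q : QuandleStr X) : Function.Injective (revList Q.op) := by
  intro l
  induction l with
  | nil =>
    intro l' h
    cases l' with
    | nil => rfl
    | cons => simp [revList] at h
  | cons a l ih =>
    intro l' h
    cases l' with
    | nil => simp [revList] at h
    | cons a' l' =>
      simp only [revList, List.cons.injEq] at h
      obtain rfl := ih h.2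
      rw [foldl_op_injective Q l h.1]

lemma foldl_op_push (Q : QuandleStr X) (u : X) (l : List X) (j : ℕ) (hj : j < l.length) :
    ((l.take j).map (fun x => Q.op x l[j]) ++ l.drop (j + 1)).foldl Q.op (Q.op u l[j]) =
      l.foldl Q.op u := by
  induction l generalizing u j with
  | nil => simp at hj
  | cons a l ih =>
    cases j with
    | zero => simp
    | succ j =>
      have hj' : j < l.length := by simpa using hj
      simpa [← Q.dist] using ih (Q.op u a) j hj'

lemma revList_push (Q : QuandleStr X) (l : List X) (j : ℕ) (hj : j < l.length) :
    revList Q.op ((l.take j).map (fun x => Q.op x l[j]) ++ l.drop (j + 1)) =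
      (revList Q.op l).eraseIdx j := by
  induction l generalizing j with
  | nil => simp at hj
  | cons a l ih =>
    cases j with
    | zero => simp [revList]
    | succ j =>
      have hj' : j < l.length := by simpa using hj
      simp only [List.take_succ_cons, List.map_cons, List.drop_succ_cons, List.getElem_cons_succ,
        List.cons_append, revList, List.eraseIdx_cons_succ, ih j hj', foldl_op_push Q a l j hj']

/-- Reversal of generating tuples, with degrees reflected by `n ↦ d - n`. -/
def revGen (Q : QuandleStr X) (d : ℤ) (t : Gen X (ℤ × X)) : Gen X (ℤ × X) :=
  ⟨((d - t.1.1.1, t.1.2.foldl Q.op t.1.1.2), revList Q.op t.1.2), (isChain_revList Q _).2 t.2⟩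

lemma revGen_injective (Q : QuandleStr X) (d : ℤ) : Function.Injective (revGen Q d) := by
  rintro ⟨⟨⟨n, u⟩, l⟩, h⟩ ⟨⟨⟨n', u'⟩, l'⟩, h'⟩ he
  simp only [revGen, Subtype.mk.injEq, Prod.mk.injEq] at he
  obtain ⟨⟨hn, hu⟩, hl⟩ := he
  obtain rfl := revList_injective Q hl
  obtain rfl := foldl_op_injective Q l hu
  obtain rfl : n = n' := by omega
  rfl

lemma mapDomain_revGen_gen (Q : QuandleStr X) (d n : ℤ) (u : X) (l : List X) :
    Finsupp.mapDomain (revGen Q d) (gen (n, u) l) =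
      gen (d - n, l.foldl Q.op u) (revList Q.op l) := by
  unfold gen
  by_cases h : l.Chain' (· ≠ ·)
  · rw [dif_pos h, dif_pos ((isChain_revList Q l).2 h), Finsupp.mapDomain_single]
    rfl
  · rw [dif_neg h, dif_neg fun h' => h ((isChain_revList Q l).1 h'), Finsupp.mapDomain_zero]

lemma reverse_eq_mapDomain (Q : QuandleStr X) (γ : Ch X (ℤ × X)) :
    reverse Q.op γ = Finsupp.mapDomain (revGen Q 0) γ := by
  unfold reverse Finsupp.mapDomain
  refine Finsupp.sum_congr fun t _ => ?_
  rw [gen, dif_pos ((isChain_revList Q _).2 t.2), Finsupp.smul_single, smul_eq_mul, mul_one]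
  simp [revGen]

lemma fOn_revGen (Q : QuandleStr X) (t : Gen X (ℤ × X)) :
    fOn (revGen Q 0 t) = -Finsupp.mapDomain (revGen Q 1) (gOn Q.op (zact Q.op) t) := by
  obtain ⟨⟨⟨n, u⟩, l⟩, h⟩ := t
  unfold fOn gOn
  rw [Finsupp.mapDomain_finsetSum, ← Finset.sum_neg_distrib]
  refine Fintype.sum_equiv (finCongr (length_revList Q.op l)) _ _ fun j => ?_
  have hj : (j : ℕ) < l.length := (length_revList Q.op l) ▸ j.2
  simp only [revGen, finCongr_apply, Fin.val_cast, Finsupp.mapDomain_smul, zact,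
    mapDomain_revGen_gen, List.get_eq_getElem]
  rw [foldl_op_push Q u l j hj, revList_push Q l j hj, pow_succ, mul_neg_one, neg_smul]
  congr 4
  ring

/-- Reversal exchanges `f` and `g`, up to sign and a shift of degree. -/
lemma fmap_reverse (Q : QuandleStr X) (γ : Ch X (ℤ × X)) :
    fmap (reverse Q.op γ) = -Finsupp.mapDomain (revGen Q 1) (gmap Q.op (zact Q.op) γ) := by
  rw [reverse_eq_mapDomain, fmap_eq_linearCombination, gmap_eq_linearCombination]
  induction γ using Finsupp.induction_linear with
  | zero => simp
  | add x y hx hy => simp only [map_add, Finsupp.mapDomain_add, hx, hy, neg_add]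
  | single t c =>
    simp only [Finsupp.mapDomain_single, Finsupp.linearCombination_single, Finsupp.mapDomain_smul,
      fOn_revGen, smul_neg]

lemma sum_fmap_reverse_eq_zero_iff (Q : QuandleStr X) {ι : Type*} (I : Finset ι)
    (γ : ι → Ch X (ℤ × X)) :
    ∑ i ∈ I, fmap (reverse Q.op (γ i)) = 0 ↔ ∑ i ∈ I, gmap Q.op (zact Q.op) (γ i) = 0 := by
  simp only [fmap_reverse, Finset.sum_neg_distrib, neg_eq_zero, ← Finsupp.mapDomain_finsetSum]
  exact (Finsupp.mapDomain_injective (revGen_injective Q 1)).eq_iff'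
    Finsupp.mapDomain_zero

lemma efficient_reverse_iff (Q : QuandleStr X) {k : ℕ} (γ : Fin k → Ch X (ℤ × X)) :
    Efficient (fun i => reverse Q.op (γ i)) ↔ Efficient γ := by
  have hneg (x : Ch X (ℤ × X)) : -Finsupp.mapDomain (revGen Q 0) x =
      Finsupp.mapDomain (revGen Q 0) (-x) :=
    (map_neg (Finsupp.mapDomain.addMonoidHom (revGen Q 0)) x).symm
  simp only [Efficient, reverse_eq_mapDomain, hneg, ne_eq,
    (Finsupp.mapDomain_injective (revGen_injective Q 0)).eq_iff]

lemma gConnected_iff_fConnected_reverse (Q : QuandleStr X) {k : ℕ} (γ : Fin k → Ch X (ℤ × X)) :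
    GConnected Q.op (zact Q.op) γ ↔ FConnected fun i => reverse Q.op (γ i) := by
  simp only [GConnected, FConnected, efficient_reverse_iff, sum_fmap_reverse_eq_zero_iff, ne_eq]

/-- `f`- and `g`-connectedness versus reverses and indices. -/
theorem fg_connectedness_properties {X : Type*} (Q : QuandleStr X) (n : ℤ) (k : ℕ)
    (hk : 0 < k) (γ : Fin k → Ch X (ℤ × X)) (ε : Fin k → ℤ) (u a b c : Fin k → X)
    (hterm : ∀ i, (ε i = 1 ∨ ε i = -1) ∧ a i ≠ b i ∧ b i ≠ c i ∧
        γ i = ε i • gen (n, u i) [a i, b i, c i]) :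
    -- (i)
    (GConnected Q.op (zact Q.op) γ ↔ FConnected fun i => reverse Q.op (γ i)) ∧
    -- (ii)
    (FConnected γ → ∀ i j, u i = u j) ∧
    -- (iii)
    (GConnected Q.op (zact Q.op) γ →
      ∀ i j, Q.op (Q.op (Q.op (u i) (a i)) (b i)) (c i) =
        Q.op (Q.op (Q.op (u j) (a j)) (b j)) (c j)) := by
  refine ⟨gConnected_iff_fConnected_reverse Q γ, fun h i j => ?_, fun h i j => ?_⟩
  · exact congrArg Prod.snd (h.base_eq (fun i => (hterm i).2.2.2) i j)
  · have hrev (i : Fin k) : reverse Q.op (γ i) = ε i •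
        gen (0 - n, [a i, b i, c i].foldl Q.op (u i)) (revList Q.op [a i, b i, c i]) := by
      rw [reverse_eq_mapDomain, (hterm i).2.2.2, Finsupp.mapDomain_smul, mapDomain_revGen_gen]
    exact congrArg Prod.snd
      (((gConnected_iff_fConnected_reverse Q γ).1 h).base_eq hrev i j)

end QHom
end

section
/- Let X be a quandle and γ₁, γ₂ two f-connected 3-terms of (X, ℤ×X) having the same degree n and the same index u. Then γ₁ + γ₂ = +(n,u; a, b, a) − (n,u; b, a, b) for some distinct elements a, b ∈ X. -/
namespace QHom

variable {X S : Type*}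

open Classical in
lemma gen_apply (s : S) (l m : List X) (h : m.Chain' (· ≠ ·)) :
    gen s l ⟨(s, m), h⟩ = if l = m then 1 else 0 := by
  unfold gen
  split_ifs with h₁ h₂ h₂
  · subst h₂; simp
  · exact Finsupp.single_eq_of_ne fun e => h₂ (by simpa using e.symm)
  · exact absurd (h₂ ▸ h) h₁
  · rfl

open Classical in
/-- The coefficient of `(s; x, y)` in the image of a 3-term under `f`. -/
lemma fmap_smul_gen_apply (s : S) (ε : ℤ) {a b c x y : X} (hab : a ≠ b) (hbc : b ≠ c)
    (h : [x, y].Chain' (· ≠ ·)) :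
    fmap (ε • gen s [a, b, c]) ⟨(s, [x, y]), h⟩ =
      ε * (-(if b = x ∧ c = y then 1 else 0) + (if a = x ∧ c = y then 1 else 0)
        - (if a = x ∧ b = y then 1 else 0)) := by
  have hc : [a, b, c].Chain' (· ≠ ·) := by simp [List.Chain', hab, hbc]
  have hg : gen s [a, b, c] = Finsupp.single ⟨(s, [a, b, c]), hc⟩ 1 := by
    unfold gen
    exact dif_pos hc
  rw [hg, fmap, Finsupp.smul_single, Finsupp.sum_single_index (by simp)]
  simp [fOn, Fin.sum_univ_three, gen_apply, sub_eq_add_neg, mul_add]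

/-- two `f`-connected 3-terms of the same degree and index form a bigon pair. -/
theorem f_connected_two {X : Type*} (Q : QuandleStr X) (n : ℤ) (u : X)
    (γ₁ γ₂ : Ch X (ℤ × X)) (h1 : IsTerm3 γ₁ n u) (h2 : IsTerm3 γ₂ n u)
    (hf : FConnected ![γ₁, γ₂]) :
    ∃ a b : X, a ≠ b ∧ γ₁ + γ₂ = gen (n, u) [a, b, a] - gen (n, u) [b, a, b] := by
  classical
  obtain ⟨ε, a, b, c, hε, hab, hbc, rfl⟩ := h1
  obtain ⟨δ, d, e, g, hδ, hde, heg, rfl⟩ := h2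
  obtain ⟨heff, hsum, -⟩ := hf
  have heff := heff 0 1 (by decide)
  simp only [Matrix.cons_val_zero, Matrix.cons_val_one] at heff
  simp only [Fin.sum_univ_two, Matrix.cons_val_zero, Matrix.cons_val_one] at hsum
  have key (x y : X) (hxy : x ≠ y) :
      ε * (-(if b = x ∧ c = y then 1 else 0) + (if a = x ∧ c = y then 1 else 0)
        - (if a = x ∧ b = y then 1 else 0)) +
      δ * (-(if e = x ∧ g = y then 1 else 0) + (if d = x ∧ g = y then 1 else 0)
        - (if d = x ∧ e = y then 1 else 0)) = 0 := by
    have h : [x, y].Chain' (· ≠ ·) := by simp [List.Chain', hxy]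
    have := DFunLike.congr_fun hsum ⟨((n, u), [x, y]), h⟩
    rwa [Finsupp.add_apply, fmap_smul_gen_apply _ _ hab hbc,
      fmap_smul_gen_apply _ _ hde heg] at this
  have k₁ := key a b hab
  have k₂ := key b c hbc
  have main : ε = -δ ∧ ((a = d ∧ b = e ∧ c = g) ∨ (a = e ∧ b = d ∧ c = e ∧ b = g)) := by
    grind
  obtain ⟨rfl, ⟨rfl, rfl, rfl⟩ | ⟨rfl, rfl, rfl, rfl⟩⟩ := main
  · exact absurd (neg_smul _ _) heff
  · rcases hδ with rfl | rfl
    · exact ⟨b, c, hbc, by simp [sub_eq_add_neg, add_comm]⟩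
    · exact ⟨c, b, hab, by simp [sub_eq_add_neg]⟩

end QHom
end

section
/- Let X be a quandle and γ₁, γ₂, γ₃ three f-connected 3-terms of (X, ℤ×X) having the same degree n and the same index u, and set γ = γ₁+γ₂+γ₃. Then, up to sign (i.e., after possibly replacing γ by −γ), one of the following holds for some mutually distinct a, b, c ∈ X (all terms having degree n and index u): (i) γ = +(a,b,a) − (c,a,b) − (c,b,a); (ii) γ = +(a,b,a) − (a,b,c) − (b,a,c). -/
namespace QHom

variable {X S : Type*}

lemma gen_of_isChain (s : S) {l : List X} (h : l.IsChain (· ≠ ·)) :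
    gen s l = Finsupp.single ⟨(s, l), h⟩ 1 :=
  dif_pos h

lemma gen_of_not_isChain (s : S) {l : List X} (h : ¬ l.IsChain (· ≠ ·)) : gen s l = 0 :=
  dif_neg h

/-- The value on a chain of the additive extension of a function on words. -/
noncomputable def evalWord (φ : List X → ℤ) : Ch X S →+ ℤ :=
  Finsupp.liftAddHom fun t => AddMonoidHom.mulRight (φ t.1.2)

lemma evalWord_gen_pair (φ : List X → ℤ) (s : S) (a b : X) (h : a = b → φ [a, b] = 0) :
    evalWord φ (gen s [a, b]) = φ [a, b] := by
  by_cases hab : a = b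
  · rw [gen_of_not_isChain s (by simp [hab]), map_zero, h hab]
  · simp [gen_of_isChain s (List.isChain_pair.2 hab), evalWord]

lemma fmap_smul_gen_triple (ε : ℤ) (s : S) {a b c : X} (hab : a ≠ b) (hbc : b ≠ c) :
    fmap (ε • gen s [a, b, c]) =
      ε • (-gen s [b, c] + gen s [a, c] - gen s [a, b]) := by
  rw [gen_of_isChain s (List.isChain_cons_cons.2 ⟨hab, List.isChain_pair.2 hbc⟩),
    Finsupp.smul_single, fmap, Finsupp.sum_single_index (by simp)]
  simp [fOn, Fin.sum_univ_three, List.eraseIdx, sub_eq_add_neg]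

lemma evalWord_fmap_smul_gen_triple (φ : X → X → ℤ) (hφ : ∀ x, φ x x = 0) (ε : ℤ) (s : S)
    {a b c : X} (hab : a ≠ b) (hbc : b ≠ c) :
    evalWord (fun l => match l with | [x, y] => φ x y | _ => 0) (fmap (ε • gen s [a, b, c])) =
      ε * (-φ b c + φ a c - φ a b) := by
  rw [fmap_smul_gen_triple ε s hab hbc, map_zsmul, map_sub, map_add, map_neg,
    evalWord_gen_pair, evalWord_gen_pair, evalWord_gen_pair, smul_eq_mul]
  all_goals rintro rfl; exact hφ _

/-- If a bigon has the same boundary as the sum of two other triples, then these two triples have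
the same first entry or the same last entry, and their other entries are those of the bigon in
its two orders. -/
lemma triples_of_bigon {a b x y z p q r : X} (hxy : x ≠ y) (hyz : y ≠ z)
    (hxz : x ≠ z) (hpq : p ≠ q) (hqr : q ≠ r) (hpr : p ≠ r)
    (h : ∀ φ : X → X → ℤ, (∀ t, φ t t = 0) →
      -φ b a - φ a b = -φ y z + φ x z - φ x y + (-φ q r + φ p r - φ p q)) :
    p = x ∧ q = z ∧ r = y ∧ (a = y ∧ b = z ∨ a = z ∧ b = y) ∨
      p = y ∧ q = x ∧ r = z ∧ (a = x ∧ b = y ∨ a = y ∧ b = x) := by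
  classical
  have key (i j : X) (hij : i ≠ j) := h (fun s t => if s = i ∧ t = j then 1 else 0)
    (fun t => if_neg fun ⟨h₁, h₂⟩ => hij (h₁.symm.trans h₂))
  have hxz' : q = x ∧ r = z ∨ p = x ∧ q = z := by
    have := key x z hxz
    grind
  have hpr' : y = p ∧ z = r ∨ x = p ∧ y = r := by
    have := key p r hpr
    grind
  have hxy' := key x y hxy
  have hyz' := key y z hyz
  clear key h
  rcases hxz' with ⟨rfl, rfl⟩ | ⟨rfl, rfl⟩ <;> grind

/-- The classification when the signs and the positions of the bigon are known. -/
lemma gen_classification_of_bigon (s : S) {a b x y z p q r : X} (hxy : x ≠ y) (hyz : y ≠ z)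
    (hxz : x ≠ z) (hpq : p ≠ q) (hqr : q ≠ r) (hpr : p ≠ r)
    (h : ∀ φ : X → X → ℤ, (∀ t, φ t t = 0) →
      -φ b a - φ a b = -φ y z + φ x z - φ x y + (-φ q r + φ p r - φ p q))
    {γ : Ch X S} (hγ : γ = gen s [a, b, a] - gen s [x, y, z] - gen s [p, q, r]) :
    ∃ a' b' c : X, a' ≠ b' ∧ a' ≠ c ∧ b' ≠ c ∧
      (γ = gen s [a', b', a'] - gen s [c, a', b'] - gen s [c, b', a'] ∨
        γ = gen s [a', b', a'] - gen s [a', b', c] - gen s [b', a', c]) := by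
  obtain ⟨rfl, rfl, rfl, ⟨rfl, rfl⟩ | ⟨rfl, rfl⟩⟩ | ⟨rfl, rfl, rfl, ⟨rfl, rfl⟩ | ⟨rfl, rfl⟩⟩ :=
    triples_of_bigon hxy hyz hxz hpq hqr hpr h
  · exact ⟨a, b, p, hyz, hxy.symm, hxz.symm, .inl hγ⟩
  · exact ⟨a, b, p, hyz.symm, hxz.symm, hxy.symm, .inl (hγ.trans (sub_right_comm _ _ _))⟩
  · exact ⟨a, b, r, hxy, hxz, hyz, .inr hγ⟩
  · exact ⟨a, b, r, hxy.symm, hyz, hxz, .inr (hγ.trans (sub_right_comm _ _ _))⟩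

/-- classification of three `f`-connected 3-terms. -/
theorem f_connected_three {X : Type*} (Q : QuandleStr X) (n : ℤ) (u : X)
    (γ₁ γ₂ γ₃ : Ch X (ℤ × X)) (h1 : IsTerm3 γ₁ n u) (h2 : IsTerm3 γ₂ n u)
    (h3 : IsTerm3 γ₃ n u) (hf : FConnected ![γ₁, γ₂, γ₃]) :
    ∃ ε : ℤ, (ε = 1 ∨ ε = -1) ∧ ∃ a b c : X, a ≠ b ∧ a ≠ c ∧ b ≠ c ∧
      (ε • (γ₁ + γ₂ + γ₃) =
          gen (n, u) [a, b, a] - gen (n, u) [c, a, b] - gen (n, u) [c, b, a] ∨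
        ε • (γ₁ + γ₂ + γ₃) =
          gen (n, u) [a, b, a] - gen (n, u) [a, b, c] - gen (n, u) [b, a, c]) := by
  classical
  obtain ⟨ε₁, a₁, b₁, c₁, hε₁, hab₁, hbc₁, rfl⟩ := h1
  obtain ⟨ε₂, a₂, b₂, c₂, hε₂, hab₂, hbc₂, rfl⟩ := h2
  obtain ⟨ε₃, a₃, b₃, c₃, hε₃, hab₃, hbc₃, rfl⟩ := h3
  have key (φ : X → X → ℤ) (hφ : ∀ x, φ x x = 0) :
      ε₁ * (-φ b₁ c₁ + φ a₁ c₁ - φ a₁ b₁) + ε₂ * (-φ b₂ c₂ + φ a₂ c₂ - φ a₂ b₂) +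
        ε₃ * (-φ b₃ c₃ + φ a₃ c₃ - φ a₃ b₃) = 0 := by
    simpa [Fin.sum_univ_three, evalWord_fmap_smul_gen_triple φ hφ, *] using
      congrArg (evalWord fun l => match l with | [x, y] => φ x y | _ => 0) hf.2.1
  have signs : (a₁ = c₁ ∧ a₂ ≠ c₂ ∧ a₃ ≠ c₃ ∧ ε₂ = -ε₁ ∧ ε₃ = -ε₁) ∨
      (a₁ ≠ c₁ ∧ a₂ = c₂ ∧ a₃ ≠ c₃ ∧ ε₁ = -ε₂ ∧ ε₃ = -ε₂) ∨
      (a₁ ≠ c₁ ∧ a₂ ≠ c₂ ∧ a₃ = c₃ ∧ ε₁ = -ε₃ ∧ ε₂ = -ε₃) := by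
    have h := key (fun s t => if s = t then 0 else 1) fun _ => if_pos rfl
    simp only [hab₁, hbc₁, hab₂, hbc₂, hab₃, hbc₃, if_false] at h
    clear key hf
    rcases hε₁ with rfl | rfl <;> rcases hε₂ with rfl | rfl <;> rcases hε₃ with rfl | rfl <;>
      split_ifs at h <;> simp_all
  rcases signs with ⟨rfl, hac₂, hac₃, rfl, rfl⟩ | ⟨hac₁, rfl, hac₃, rfl, rfl⟩ |
    ⟨hac₁, hac₂, rfl, rfl, rfl⟩
  · refine ⟨ε₁, hε₁, gen_classification_of_bigon (n, u) (a := a₁) (b := b₁)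
      hab₂ hbc₂ hac₂ hab₃ hbc₃ hac₃ (fun φ hφ => ?_) ?_⟩
    · have := key φ hφ
      rw [hφ a₁] at this
      rcases hε₁ with rfl | rfl <;> linarith
    · rcases hε₁ with rfl | rfl <;> module
  · refine ⟨ε₂, hε₂, gen_classification_of_bigon (n, u) (a := a₂) (b := b₂)
      hab₁ hbc₁ hac₁ hab₃ hbc₃ hac₃ (fun φ hφ => ?_) ?_⟩
    · have := key φ hφ
      rw [hφ a₂] at this
      rcases hε₂ with rfl | rfl <;> linarith
    · rcases hε₂ with rfl | rfl <;> module
  · refine ⟨ε₃, hε₃, gen_classification_of_bigon (n, u) (a := a₃) (b := b₃)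
      hab₁ hbc₁ hac₁ hab₂ hbc₂ hac₂ (fun φ hφ => ?_) ?_⟩
    · have := key φ hφ
      rw [hφ a₃] at this
      rcases hε₃ with rfl | rfl <;> linarith
    · rcases hε₃ with rfl | rfl <;> module

end QHom
end
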